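/- arXiv:math/0702800 — 2 statements merged into one kernel-verified Lean document; each statement's English description precedes it below -/
import Mathlib

section
/- (Approximation by rectangular paths.) Call a ∈ X elementary rectangular if there exist n ≥ 1 and c ∈ ℂ such that a_n is the constant function c on I_T and a_j = 0 for all j ≠ n. Then for every a ∈ X and every N ≥ 1 there exists b ∈ X which is a finite *-product of elementary rectangular elements such that I_{i_1,…,i_k}(b) = I_{i_1,…,i_k}(a) for every multi-index of positive integers with i_1+⋯+i_k ≤ N. -/
open MeasureTheory

noncomputable section

/-- The class `X`: sequences `a = (a₁, a₂, …)` of bounded measurable functions on `[0,T]`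
with `sup_{x,i} |aᵢ(x)|^{1/i} < ∞` (equivalently `‖aᵢ(x)‖ ≤ Cⁱ` for some `C`).
We index by `ℕ`, using only indices `i ≥ 1`. -/
def MemX (T : ℝ) (a : ℕ → ℝ → ℂ) : Prop :=
  (∀ i, Measurable (a i)) ∧
    ∃ C : ℝ, ∀ i : ℕ, 1 ≤ i → ∀ x ∈ Set.Icc (0 : ℝ) T, ‖a i x‖ ≤ C ^ i

/-- Auxiliary iterated integral: for the multi-index list `[j₁, …, jₖ]` (outermost first),
`itIntAux a [j₁,…,jₖ] x = ∫_{0 ≤ s_k ≤ … ≤ s_1 ≤ x} a_{j₁}(s₁)⋯a_{jₖ}(sₖ) ds`. -/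
def itIntAux (a : ℕ → ℝ → ℂ) : List ℕ → ℝ → ℂ
  | [], _ => 1
  | i :: l, x => ∫ s in (0 : ℝ)..x, a i s * itIntAux a l s

/-- The basic iterated integral `I_{i₁,…,iₖ}(a)` over `0 ≤ s₁ ≤ ⋯ ≤ sₖ ≤ T`,
with the multi-index encoded as the list `[i₁, …, iₖ]` (so the empty list gives `1`). -/
def itInt (T : ℝ) (a : ℕ → ℝ → ℂ) (l : List ℕ) : ℂ :=
  itIntAux a l.reverse T

/-- The product `a * b` on `X`: traverse (rescaled) `b` on `[0, T/2]`, then `a`. -/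
def starProd (T : ℝ) (a b : ℕ → ℝ → ℂ) : ℕ → ℝ → ℂ := fun i x =>
  if x ≤ T / 2 then 2 * b i (2 * x) else 2 * a i (2 * x - T)


/-- `a` is elementary rectangular: for some `n ≥ 1` and `c ∈ ℂ`, `aₙ` is the constant
function `c` and `a_j = 0` for all `j ≠ n`. -/
def ElemRect (a : ℕ → ℝ → ℂ) : Prop :=
  ∃ n : ℕ, 1 ≤ n ∧ ∃ c : ℂ, (∀ x : ℝ, a n x = c) ∧ ∀ j ≠ n, ∀ x : ℝ, a j x = 0
def LB (f : ℝ → ℂ) : Prop :=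
  Measurable f ∧ ∀ R : ℝ, ∃ C : ℝ, ∀ x : ℝ, |x| ≤ R → ‖f x‖ ≤ C

theorem LB.intInt {f : ℝ → ℂ} (h : LB f) (x y : ℝ) : IntervalIntegrable f volume x y := by
  obtain ⟨C, hC⟩ := h.2 (max |x| |y|)
  rw [intervalIntegrable_iff]
  refine Measure.integrableOn_of_bounded (M := C) ?_ h.1.aestronglyMeasurable ?_
  · simp
  · refine (ae_restrict_iff' measurableSet_uIoc).2 (Filter.Eventually.of_forall fun s hs => hC s ?_)
    exact abs_le_max_abs_abs hs.1.le hs.2 |>.trans (by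
      rcases le_total x y with h | h <;> simp [h, le_total])

theorem LB.add {f g : ℝ → ℂ} (hf : LB f) (hg : LB g) : LB (fun x => f x + g x) := by
  refine ⟨hf.1.add hg.1, fun R => ?_⟩
  obtain ⟨C, hC⟩ := hf.2 R
  obtain ⟨D, hD⟩ := hg.2 R
  exact ⟨C + D, fun x hx => (norm_add_le _ _).trans (add_le_add (hC x hx) (hD x hx))⟩

theorem LB.mul {f g : ℝ → ℂ} (hf : LB f) (hg : LB g) : LB (fun x => f x * g x) := by
  refine ⟨hf.1.mul hg.1, fun R => ?_⟩
  obtain ⟨C, hC⟩ := hf.2 R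
  obtain ⟨D, hD⟩ := hg.2 R
  refine ⟨C * D, fun x hx => ?_⟩
  rw [norm_mul]
  exact mul_le_mul (hC x hx) (hD x hx) (norm_nonneg _) ((norm_nonneg _).trans (hC x hx))

theorem LB.of_cont {f : ℝ → ℂ} (hf : Continuous f) : LB f := by
  refine ⟨hf.measurable, fun R => ?_⟩
  obtain ⟨C, hC⟩ := (isCompact_Icc (a := -R) (b := R)).exists_bound_of_continuousOn hf.continuousOn
  exact ⟨C, fun x hx => hC x (abs_le.1 hx)⟩

theorem LB.const (c : ℂ) : LB (fun _ => c) := LB.of_cont continuous_const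

theorem LB.sub {f g : ℝ → ℂ} (hf : LB f) (hg : LB g) : LB (fun x => f x - g x) := by
  have := hf.add ((LB.const (-1)).mul hg)
  simpa [sub_eq_add_neg] using this

theorem LB.cont_int {f : ℝ → ℂ} (hf : LB f) : Continuous (fun x => ∫ s in (0:ℝ)..x, f s) :=
  intervalIntegral.continuous_primitive (fun a b => hf.intInt a b) 0

theorem LB.ac {f : ℝ → ℂ} (hf : LB f) (x : ℝ) :
    AbsolutelyContinuousOnInterval (fun x => ∫ s in (0:ℝ)..x, f s) 0 x := by
  obtain ⟨C, hC⟩ := hf.2 |x|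
  have hC0 : 0 ≤ C := (norm_nonneg _).trans (hC x le_rfl)
  apply LipschitzOnWith.absolutelyContinuousOnInterval (K := ⟨C, hC0⟩)
  apply LipschitzOnWith.of_dist_le_mul
  intro y hy z hz
  rw [dist_eq_norm, intervalIntegral.integral_interval_sub_left (hf.intInt _ _) (hf.intInt _ _),
    Real.dist_eq]
  apply intervalIntegral.norm_integral_le_of_norm_le_const
  intro s hs
  apply hC
  have h1 : s ∈ Set.uIcc 0 x := by
    have := Set.uIcc_subset_uIcc hz hy
    exact this (Set.uIoc_subset_uIcc hs)
  rcases le_total 0 x with h | h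
  · rw [Set.uIcc_of_le h] at h1
    rw [abs_of_nonneg h1.1, abs_of_nonneg h]; exact h1.2
  · rw [Set.uIcc_of_ge h] at h1
    rw [abs_of_nonpos h1.2, abs_of_nonpos h]; linarith [h1.1]

def HI (f f' : ℝ → ℂ) : Prop := LB f' ∧ ∀ x, f x = f 0 + ∫ s in (0:ℝ)..x, f' s

theorem HI.cont {f f' : ℝ → ℂ} (h : HI f f') : Continuous f := by
  have : f = fun x => f 0 + ∫ s in (0:ℝ)..x, f' s := funext h.2
  rw [this]
  exact continuous_const.add h.1.cont_int

theorem HI.add {f f' g g' : ℝ → ℂ} (hf : HI f f') (hg : HI g g') :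
    HI (fun x => f x + g x) (fun x => f' x + g' x) := by
  refine ⟨hf.1.add hg.1, fun x => ?_⟩
  rw [intervalIntegral.integral_add (hf.1.intInt _ _) (hg.1.intInt _ _)]; beta_reduce; rw [hf.2 x, hg.2 x]
  ring

theorem HI.const (c : ℂ) : HI (fun _ => c) (fun _ => 0) := ⟨LB.const 0, by simp⟩

theorem HI.ac {f f' : ℝ → ℂ} (h : HI f f') (x : ℝ) : AbsolutelyContinuousOnInterval f 0 x := by
  have : f = fun x => f 0 + ∫ s in (0:ℝ)..x, f' s := funext h.2
  rw [this]
  refine AbsolutelyContinuousOnInterval.fun_add ?_ (h.1.ac x)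
  apply LipschitzOnWith.absolutelyContinuousOnInterval (K := 0)
  apply LipschitzOnWith.of_dist_le_mul
  simp

theorem HI.ae {f f' : ℝ → ℂ} (h : HI f f') (x : ℝ) :
    ∀ᵐ y, y ∈ Set.uIcc 0 x → HasDerivAt f (f' y) y := by
  have h2 : f = fun x => f 0 + ∫ s in (0:ℝ)..x, f' s := funext h.2
  filter_upwards [(h.1.intInt 0 x).ae_hasDerivAt_integral] with y hy hyx
  rw [h2]
  exact (hy hyx 0 Set.left_mem_uIcc).const_add _

theorem HI.mul {f f' g g' : ℝ → ℂ} (hf : HI f f') (hg : HI g g') :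
    HI (fun x => f x * g x) (fun x => f' x * g x + f x * g' x) := by
  have hLB : LB (fun x => f' x * g x + f x * g' x) :=
    (hf.1.mul (LB.of_cont hg.cont)).add ((LB.of_cont hf.cont).mul hg.1)
  refine ⟨hLB, fun x => ?_⟩
  have hP : HI (fun x => ∫ s in (0:ℝ)..x, (f' s * g s + f s * g' s))
    (fun x => f' x * g x + f x * g' x) := ⟨hLB, by simp⟩
  have hac : AbsolutelyContinuousOnInterval
      (fun x => f x * g x - ∫ s in (0:ℝ)..x, (f' s * g s + f s * g' s)) 0 x :=
    AbsolutelyContinuousOnInterval.fun_sub ((hf.ac x).fun_smul (hg.ac x)) (hP.ac x)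
  obtain ⟨C, hC⟩ := hac.const_of_ae_hasDerivAt_zero (by
    filter_upwards [hf.ae x, hg.ae x, hP.ae x] with y h1 h2 h3 hy
    have := ((h1 hy).mul (h2 hy)).sub (h3 hy)
    rw [sub_self] at this
    exact this)
  have e0 := hC 0 Set.left_mem_uIcc
  have ex := hC x Set.right_mem_uIcc
  simp only [intervalIntegral.integral_same, sub_zero] at e0
  rw [← e0] at ex
  linear_combination ex
/-- Noncommutative series: functions on words. -/
def NC : Type := List ℕ → ℂ

instance : AddCommGroup NC := inferInstanceAs (AddCommGroup (List ℕ → ℂ))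
instance : Module ℂ NC := inferInstanceAs (Module ℂ (List ℕ → ℂ))

theorem NC.add_apply (f g : NC) (w : List ℕ) : (f + g) w = f w + g w := rfl
theorem NC.sub_apply (f g : NC) (w : List ℕ) : (f - g) w = f w - g w := rfl
theorem NC.neg_apply (f : NC) (w : List ℕ) : (-f) w = - f w := rfl
theorem NC.zero_apply (w : List ℕ) : (0 : NC) w = 0 := rfl
theorem NC.smul_apply (c : ℂ) (f : NC) (w : List ℕ) : (c • f) w = c * f w := rfl
theorem NC.ext {f g : NC} (h : ∀ w, f w = g w) : f = g := funext h

def sh (i : ℕ) (f : NC) : NC := fun w => f (i :: w)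

def cv : List ℕ → NC → NC → ℂ
  | [], f, g => f [] * g []
  | i :: l, f, g => f [] * g (i :: l) + cv l (sh i f) g

instance : Mul NC := ⟨fun f g w => cv w f g⟩
instance : One NC := ⟨fun w => if w = [] then 1 else 0⟩

theorem NC.mul_nil (f g : NC) : (f * g) [] = f [] * g [] := rfl
theorem NC.mul_cons (f g : NC) (i : ℕ) (l : List ℕ) :
    (f * g) (i :: l) = f [] * g (i :: l) + (sh i f * g) l := rfl
theorem NC.one_nil : (1 : NC) [] = 1 := rfl
theorem NC.one_cons (i : ℕ) (l : List ℕ) : (1 : NC) (i :: l) = 0 := by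
  show (if (i :: l) = [] then (1:ℂ) else 0) = 0
  simp

theorem NC.add_mul' (f g h : NC) : (f + g) * h = f * h + g * h := by
  apply NC.ext; intro w
  induction w generalizing f g with
  | nil => simp only [NC.add_apply, NC.mul_nil]; ring
  | cons i l ih =>
    have : sh i (f + g) = sh i f + sh i g := rfl
    simp only [NC.mul_cons, NC.add_apply, this, ih]; ring

theorem NC.mul_add' (f g h : NC) : f * (g + h) = f * g + f * h := by
  apply NC.ext; intro w
  induction w generalizing f with
  | nil => simp only [NC.add_apply, NC.mul_nil]; ring
  | cons i l ih =>
    simp only [NC.mul_cons, NC.add_apply, ih]; ring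

theorem NC.smul_mul' (c : ℂ) (f g : NC) : (c • f) * g = c • (f * g) := by
  apply NC.ext; intro w
  induction w generalizing f with
  | nil => simp only [NC.smul_apply, NC.mul_nil]; ring
  | cons i l ih =>
    have : sh i (c • f) = c • sh i f := rfl
    simp only [NC.mul_cons, this, ih, NC.smul_apply]; ring

theorem NC.mul_smul' (c : ℂ) (f g : NC) : f * (c • g) = c • (f * g) := by
  apply NC.ext; intro w
  induction w generalizing f with
  | nil => simp only [NC.smul_apply, NC.mul_nil]; ring
  | cons i l ih =>
    simp only [NC.mul_cons, ih, NC.smul_apply]; ring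

theorem NC.mul_assoc' (f g h : NC) : (f * g) * h = f * (g * h) := by
  apply NC.ext; intro w
  induction w generalizing f with
  | nil => simp only [NC.mul_nil]; ring
  | cons i l ih =>
    have : sh i (f * g) = f [] • sh i g + sh i f * g := rfl
    simp only [NC.mul_cons, NC.mul_nil, this, NC.add_mul', NC.smul_mul', NC.add_apply, ih,
      NC.smul_apply]
    ring

theorem NC.zero_mul' (f : NC) : 0 * f = 0 := by
  simpa using NC.smul_mul' 0 0 f
theorem NC.mul_zero' (f : NC) : f * 0 = 0 := by
  simpa using NC.mul_smul' 0 f 0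

theorem NC.one_mul' (f : NC) : 1 * f = f := by
  apply NC.ext; intro w
  cases w with
  | nil => simp [NC.mul_nil, NC.one_nil]
  | cons i l =>
    have : sh i 1 = 0 := NC.ext fun w => NC.one_cons i w
    simp [NC.mul_cons, NC.one_nil, this, NC.zero_mul', NC.zero_apply]

theorem NC.mul_one' (f : NC) : f * 1 = f := by
  apply NC.ext; intro w
  induction w generalizing f with
  | nil => simp [NC.mul_nil, NC.one_nil]
  | cons i l ih => simp [NC.mul_cons, NC.one_cons, ih, sh]

instance : Ring NC :=
  { (inferInstance : AddCommGroup NC), (inferInstance : Mul NC), (inferInstance : One NC) with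
    left_distrib := NC.mul_add'
    right_distrib := NC.add_mul'
    zero_mul := NC.zero_mul'
    mul_zero := NC.mul_zero'
    mul_assoc := NC.mul_assoc'
    one_mul := NC.one_mul'
    mul_one := NC.mul_one' }

instance : IsScalarTower ℂ NC NC := ⟨fun c f g => NC.smul_mul' c f g⟩
instance : SMulCommClass ℂ NC NC := ⟨fun c f g => (NC.mul_smul' c f g).symm⟩

/-- weight of a word; letter `i` has weight `i + 1` -/
def wt (w : List ℕ) : ℕ := w.sum + w.length

theorem wt_nil : wt [] = 0 := rfl
theorem wt_cons (i : ℕ) (l : List ℕ) : wt (i :: l) = i + 1 + wt l := by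
  simp [wt]; ring
theorem wt_append (u v : List ℕ) : wt (u ++ v) = wt u + wt v := by
  simp [wt]; ring
theorem wt_eq_zero {w : List ℕ} (h : wt w = 0) : w = [] := by
  cases w with
  | nil => rfl
  | cons i l => rw [wt_cons] at h; omega

theorem NC.mul_supp (f g : NC) (w : List ℕ) (h : (f * g) w ≠ 0) :
    ∃ u v, w = u ++ v ∧ f u ≠ 0 ∧ g v ≠ 0 := by
  induction w generalizing f with
  | nil => exact ⟨[], [], rfl, left_ne_zero_of_mul h, right_ne_zero_of_mul h⟩
  | cons i l ih =>
    rw [NC.mul_cons] at h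
    by_cases h1 : f [] * g (i :: l) = 0
    · rw [h1, zero_add] at h
      obtain ⟨u, v, rfl, hu, hv⟩ := ih _ h
      exact ⟨i :: u, v, rfl, hu, hv⟩
    · exact ⟨[], i :: l, rfl, left_ne_zero_of_mul h1, right_ne_zero_of_mul h1⟩

/-- series of order at least `d` -/
def Idl (d : ℕ) : Submodule ℂ NC where
  carrier := {f | ∀ w, wt w < d → f w = 0}
  add_mem' := by
    intro f g hf hg w hw
    rw [NC.add_apply, hf w hw, hg w hw, add_zero]
  zero_mem' := fun w _ => rfl
  smul_mem' := by
    intro c f hf w hw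
    rw [NC.smul_apply, hf w hw, mul_zero]

theorem Idl_mul {c d : ℕ} {f g : NC} (hf : f ∈ Idl c) (hg : g ∈ Idl d) : f * g ∈ Idl (c + d) := by
  intro w hw
  by_contra h
  obtain ⟨u, v, rfl, hu, hv⟩ := NC.mul_supp f g w h
  rw [wt_append] at hw
  have h1 : c ≤ wt u := by by_contra h; exact hu (hf u (by omega))
  have h2 : d ≤ wt v := by by_contra h; exact hv (hg v (by omega))
  omega

theorem Idl_mono {c d : ℕ} (h : c ≤ d) {f : NC} (hf : f ∈ Idl d) : f ∈ Idl c :=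
  fun w hw => hf w (by omega)

theorem Idl_zero (f : NC) : f ∈ Idl 0 := fun w hw => by omega

theorem Idl_mul_right {c : ℕ} {f : NC} (hf : f ∈ Idl c) (g : NC) : f * g ∈ Idl c :=
  Idl_mul hf (Idl_zero g)
theorem Idl_mul_left {c : ℕ} {f : NC} (g : NC) (hf : f ∈ Idl c) : g * f ∈ Idl c := by
  simpa using Idl_mul (Idl_zero g) hf

def Hom (d : ℕ) (f : NC) : Prop := ∀ w, wt w ≠ d → f w = 0

theorem Hom.idl {d : ℕ} {f : NC} (h : Hom d f) : f ∈ Idl d := fun w hw => h w (by omega)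

theorem Hom.mul {c d : ℕ} {f g : NC} (hf : Hom c f) (hg : Hom d g) : Hom (c + d) (f * g) := by
  intro w hw
  by_contra h
  obtain ⟨u, v, rfl, hu, hv⟩ := NC.mul_supp f g w h
  rw [wt_append] at hw
  have h1 : wt u = c := by by_contra h; exact hu (hf u h)
  have h2 : wt v = d := by by_contra h; exact hv (hg v h)
  omega

/-- homogeneous component -/
def comp (d : ℕ) (f : NC) : NC := fun w => if wt w = d then f w else 0

theorem comp_hom (d : ℕ) (f : NC) : Hom d (comp d f) := fun w hw => by simp [comp, hw]

theorem sub_comp_mem {d : ℕ} {f : NC} (hf : f ∈ Idl d) : f - comp d f ∈ Idl (d + 1) := by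
  intro w hw
  rw [NC.sub_apply, comp]
  split_ifs with h
  · simp
  · rw [hf w (by omega), sub_zero]

/-- letters -/
def tt (n : ℕ) : NC := fun w => if w = [n] then 1 else 0

theorem tt_hom (n : ℕ) : Hom (n + 1) (tt n) := by
  intro w hw
  rw [tt, if_neg]
  rintro rfl
  exact hw (by simp [wt])

/-- degree one series with coefficients `α` -/
def lin (α : ℕ → ℂ) : NC
  | [i] => α i
  | _ => 0

theorem lin_mul_nil (α : ℕ → ℂ) (f : NC) : (lin α * f) [] = 0 := by
  simp [NC.mul_nil, lin]

theorem lin_mul_cons (α : ℕ → ℂ) (f : NC) (i : ℕ) (l : List ℕ) :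
    (lin α * f) (i :: l) = α i * f l := by
  have : sh i (lin α) = α i • (1 : NC) := by
    apply NC.ext; intro w
    cases w with
    | nil => simp [sh, lin, NC.smul_apply, NC.one_nil]
    | cons j w => simp [sh, lin, NC.smul_apply, NC.one_cons]
  rw [NC.mul_cons, this, smul_mul_assoc, one_mul, NC.smul_apply]
  simp [lin]

theorem mul_lin_nil (α : ℕ → ℂ) (f : NC) : (f * lin α) [] = 0 := by
  simp [NC.mul_nil, lin]

theorem mul_lin_concat (α : ℕ → ℂ) (f : NC) (l : List ℕ) (j : ℕ) :
    (f * lin α) (l ++ [j]) = f l * α j := by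
  induction l generalizing f with
  | nil => simp [NC.mul_cons, NC.mul_nil, lin]
  | cons i l ih =>
    rw [List.cons_append, NC.mul_cons, ih]
    have : lin α (i :: (l ++ [j])) = 0 := by
      cases l <;> rfl
    simp [this, sh]

theorem tt_eq_lin (n : ℕ) : tt n = lin (fun i => if i = n then 1 else 0) := by
  apply NC.ext; intro w
  match w with
  | [] => simp [tt, lin]
  | [i] => simp [tt, lin]
  | i :: j :: l => simp [tt, lin]

theorem comp_lin_mul (α : ℕ → ℂ) (f : NC) (d : ℕ) :
    comp d (lin α * f) = ∑ k ∈ Finset.range d, α k • (tt k * comp (d - 1 - k) f) := by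
  apply NC.ext; intro w
  have hs : ∀ (s : Finset ℕ) (F : ℕ → NC), (∑ k ∈ s, F k) w = ∑ k ∈ s, F k w := fun s F =>
    Finset.sum_apply (M := fun _ : List ℕ => ℂ) w s F
  rw [hs]
  cases w with
  | nil =>
    simp [comp, lin_mul_nil, NC.smul_apply, tt_eq_lin]
  | cons i l =>
    simp only [comp, lin_mul_cons, NC.smul_apply, tt_eq_lin, wt_cons]
    have : ∀ k ∈ Finset.range d, α k * ((if i = k then (1:ℂ) else 0) *
        (if wt l = d - 1 - k then f l else 0)) =
        if i = k then (if wt l = d - 1 - i then α i * f l else 0) else 0 := by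
      intro k _
      by_cases h : i = k
      · subst h; simp
      · simp [h]
    rw [Finset.sum_congr rfl this, Finset.sum_ite_eq]
    simp only [Finset.mem_range]
    grind

theorem comp_mul_lin (α : ℕ → ℂ) (f : NC) (d : ℕ) :
    comp d (f * lin α) = ∑ k ∈ Finset.range d, α k • (comp (d - 1 - k) f * tt k) := by
  apply NC.ext; intro w
  have hs : ∀ (s : Finset ℕ) (F : ℕ → NC), (∑ k ∈ s, F k) w = ∑ k ∈ s, F k w := fun s F =>
    Finset.sum_apply (M := fun _ : List ℕ => ℂ) w s F
  rw [hs]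
  rcases List.eq_nil_or_concat w with rfl | ⟨l, i, rfl⟩
  · simp [comp, mul_lin_nil, NC.smul_apply, tt_eq_lin]
  · simp only [List.concat_eq_append, comp, mul_lin_concat, NC.smul_apply, tt_eq_lin, wt_append,
      wt_cons, wt_nil]
    simp only [mul_one, mul_ite, mul_zero]
    rw [Finset.sum_ite_eq]
    simp only [Finset.mem_range]
    grind

/-- dilation -/
def dilF (z : ℂ) (f : NC) : NC := fun w => z ^ wt w * f w

theorem dilF_apply (z : ℂ) (f : NC) (w : List ℕ) : dilF z f w = z ^ wt w * f w := rfl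

theorem sh_dilF (z : ℂ) (f : NC) (i : ℕ) : sh i (dilF z f) = z ^ (i + 1) • dilF z (sh i f) := by
  apply NC.ext; intro w
  rw [NC.smul_apply, dilF_apply, sh, dilF_apply, wt_cons, pow_add, sh]; ring

def dil (z : ℂ) : NC →+* NC where
  toFun f := dilF z f
  map_one' := by
    apply NC.ext; intro w
    cases w with
    | nil => simp [wt_nil, NC.one_nil, dilF_apply]
    | cons i l => simp [NC.one_cons, dilF_apply]
  map_zero' := by
    apply NC.ext; intro w
    simp [NC.zero_apply, dilF_apply]
  map_add' f g := by
    apply NC.ext; intro w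
    simp only [NC.add_apply, dilF_apply]; ring
  map_mul' f g := by
    apply NC.ext; intro w
    induction w generalizing f with
    | nil => simp [NC.mul_nil, wt_nil, dilF_apply]
    | cons i l ih =>
      rw [NC.mul_cons, dilF_apply, NC.mul_cons, sh_dilF, smul_mul_assoc, NC.smul_apply, ← ih]
      simp only [wt_cons, wt_nil, pow_add, dilF_apply]
      ring

theorem dil_apply (z : ℂ) (f : NC) (w : List ℕ) : dil z f w = z ^ wt w * f w := rfl

theorem dil_idl (z : ℂ) {f : NC} {d : ℕ} (h : f ∈ Idl d) : dil z f ∈ Idl d := by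
  intro w hw
  rw [dil_apply, h w hw, mul_zero]

theorem dil_hom (z : ℂ) {f : NC} {d : ℕ} (h : Hom d f) : dil z f = z ^ d • f := by
  apply NC.ext; intro w
  rw [dil_apply, NC.smul_apply]
  by_cases hw : wt w = d
  · rw [hw]
  · rw [h w hw, mul_zero, mul_zero]

/-- one-letter series -/
def emb (n : ℕ) (α : ℕ → ℂ) : NC := fun w => if (∀ i ∈ w, i = n) then α w.length else 0

theorem sh_emb_self (n : ℕ) (α : ℕ → ℂ) : sh n (emb n α) = emb n (fun k => α (k + 1)) := by
  apply NC.ext; intro w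
  simp [sh, emb]

theorem sh_emb_ne {i n : ℕ} (h : i ≠ n) (α : ℕ → ℂ) : sh i (emb n α) = 0 := by
  apply NC.ext; intro w
  simp [sh, emb, h, NC.zero_apply]

theorem emb_mul (n : ℕ) (α β : ℕ → ℂ) :
    emb n α * emb n β =
      emb n (fun k => ∑ p ∈ Finset.HasAntidiagonal.antidiagonal k, α p.1 * β p.2) := by
  apply NC.ext; intro w
  induction w generalizing α with
  | nil => simp [NC.mul_nil, emb]
  | cons i l ih =>
    rw [NC.mul_cons]
    by_cases h : i = n
    · subst h
      rw [sh_emb_self, ih]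
      simp only [emb, List.mem_cons, forall_eq_or_imp, true_and, List.length_cons,
        Finset.Nat.sum_antidiagonal_succ]
      by_cases hl : ∀ j ∈ l, j = i
      · simp only [if_pos hl]; simp
      · simp [if_neg hl]
    · rw [sh_emb_ne h, zero_mul]
      simp [emb, h, NC.zero_apply]

def ex (n : ℕ) (c : ℂ) : NC := emb n (fun k => c ^ k / (k.factorial : ℂ))

theorem ex_mul (n : ℕ) (c d : ℂ) : ex n c * ex n d = ex n (c + d) := by
  rw [ex, ex, emb_mul, ex]
  congr 1
  ext k
  rw [add_pow, Finset.Nat.sum_antidiagonal_eq_sum_range_succ_mk, Finset.sum_div]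
  refine Finset.sum_congr rfl fun i hi => ?_
  have hi' : i ≤ k := by simpa [Nat.lt_succ_iff] using hi
  rw [Nat.cast_choose ℂ hi']
  have := Nat.cast_ne_zero (R := ℂ).2 (Nat.factorial_ne_zero k)
  field_simp

theorem ex_zero (n : ℕ) : ex n 0 = 1 := by
  apply NC.ext; intro w
  cases w with
  | nil => simp [ex, emb, NC.one_nil]
  | cons i l => simp [ex, emb, NC.one_cons]

theorem dil_ex (z : ℂ) (n : ℕ) (c : ℂ) : dil z (ex n c) = ex n (z ^ (n + 1) * c) := by
  apply NC.ext; intro w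
  rw [dil_apply, ex, ex, emb, emb]
  split_ifs with h
  · have : wt w = (n + 1) * w.length := by
      rw [wt, List.sum_eq_card_nsmul w n h]; simp; ring
    rw [this, mul_pow, pow_mul]; ring
  · simp

def exU (n : ℕ) (c : ℂ) : NCˣ :=
  ⟨ex n c, ex n (-c), by rw [ex_mul, add_neg_cancel, ex_zero], by rw [ex_mul, neg_add_cancel, ex_zero]⟩

def EE : Subgroup NCˣ := Subgroup.closure {u | ∃ n c, 1 ≤ n ∧ u = exU n c}

theorem exU_mem {n : ℕ} (hn : 1 ≤ n) (c : ℂ) : exU n c ∈ EE := Subgroup.subset_closure ⟨n, c, hn, rfl⟩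

theorem EE_dil (z : ℂ) {e : NCˣ} (he : e ∈ EE) : Units.map (dil z : NC →* NC) e ∈ EE := by
  have : EE ≤ EE.comap (Units.map (dil z : NC →* NC)) := by
    conv_lhs => rw [EE]
    rw [Subgroup.closure_le]
    rintro _ ⟨n, c, hn, rfl⟩
    have : Units.map (dil z : NC →* NC) (exU n c) = exU n (z ^ (n + 1) * c) := by
      ext
      exact dil_ex z n c
    show Units.map (dil z : NC →* NC) (exU n c) ∈ EE
    rw [this]
    exact exU_mem hn _
  exact this he

theorem EE_list {e : NCˣ} (he : e ∈ EE) :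
    ∃ L : List (ℕ × ℂ), (∀ p ∈ L, 1 ≤ p.1) ∧ (e : NC) = (L.map fun p => ex p.1 p.2).prod := by
  unfold EE at he
  induction he using Subgroup.closure_induction_left with
  | one => exact ⟨[], by simp, by simp⟩
  | mul_left u hu v _ ih =>
    obtain ⟨n, c, hn, rfl⟩ := hu
    obtain ⟨L, hL, h⟩ := ih
    refine ⟨(n, c) :: L, by simpa [hn] using hL, ?_⟩
    rw [Units.val_mul, h]; simp [exU]
  | inv_mul_cancel u hu v _ ih =>
    obtain ⟨n, c, hn, rfl⟩ := hu
    obtain ⟨L, hL, h⟩ := ih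
    refine ⟨(n, -c) :: L, by simpa [hn] using hL, ?_⟩
    rw [Units.val_mul, h]; simp [exU]
def WS (d : ℕ) : Set NC :=
  {v | Hom d v ∧ v [] = 0 ∧ ∃ e ∈ EE, ((e : NCˣ) : NC) - 1 - v ∈ Idl (d + 1)}

theorem WS_zero_mem (d : ℕ) : (0 : NC) ∈ WS d :=
  ⟨fun _ _ => rfl, rfl, 1, EE.one_mem, by simp⟩

theorem WS_d0 {v : NC} (h : v ∈ WS 0) : v = 0 := by
  apply NC.ext; intro w
  by_cases hw : wt w = 0
  · rw [wt_eq_zero hw]; exact h.2.1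
  · exact h.1 w hw

theorem WS_one_mem {d : ℕ} {e v : NC} (hv : Hom d v) (h : e - 1 - v ∈ Idl (d + 1)) :
    e - 1 ∈ Idl d := by
  have := (Idl d).add_mem (Idl_mono (Nat.le_succ d) h) hv.idl
  simpa using this

theorem WS_add {d : ℕ} {v w : NC} (hv : v ∈ WS d) (hw : w ∈ WS d) : v + w ∈ WS d := by
  rcases Nat.eq_zero_or_pos d with rfl | hd
  · rw [WS_d0 hv, WS_d0 hw, add_zero]; exact WS_zero_mem 0
  obtain ⟨hv1, hv2, e, he, hev⟩ := hv
  obtain ⟨hw1, hw2, f, hf, hfw⟩ := hw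
  refine ⟨fun u hu => by rw [NC.add_apply, hv1 u hu, hw1 u hu, add_zero],
    by rw [NC.add_apply, hv2, hw2, add_zero], e * f, EE.mul_mem he hf, ?_⟩
  have h1 := Idl_mono (show d + 1 ≤ d + d by omega)
    (Idl_mul (WS_one_mem hv1 hev) (WS_one_mem hw1 hfw))
  have := (Idl (d+1)).add_mem (Submodule.add_mem _ h1 hev) hfw
  convert this using 1
  rw [Units.val_mul]
  noncomm_ring

theorem WS_smul {d : ℕ} (c : ℂ) {v : NC} (hv : v ∈ WS d) : c • v ∈ WS d := by
  rcases Nat.eq_zero_or_pos d with rfl | hd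
  · rw [WS_d0 hv, smul_zero]; exact WS_zero_mem 0
  obtain ⟨z, hz⟩ := IsAlgClosed.exists_pow_nat_eq c hd
  obtain ⟨hv1, hv2, e, he, hev⟩ := hv
  refine ⟨fun u hu => by rw [NC.smul_apply, hv1 u hu, mul_zero],
    by rw [NC.smul_apply, hv2, mul_zero], _, EE_dil z he, ?_⟩
  have := dil_idl z hev
  rw [map_sub, map_sub, map_one, dil_hom z hv1, hz] at this
  exact this

def W (d : ℕ) : Submodule ℂ NC where
  carrier := WS d
  add_mem' := WS_add
  zero_mem' := WS_zero_mem d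
  smul_mem' := fun c _ h => WS_smul c h

theorem inv_sub_one_mem {d : ℕ} (e : NCˣ) (h : (e : NC) - 1 ∈ Idl d) :
    ((e⁻¹ : NCˣ) : NC) - 1 ∈ Idl d := by
  have := (Idl d).neg_mem (Idl_mul_right h ((e⁻¹ : NCˣ) : NC))
  convert this using 1
  rw [sub_mul, Units.mul_inv]; simp

theorem W_bracket {c d : ℕ} {v w : NC} (hv : v ∈ W c) (hw : w ∈ W d) :
    v * w - w * v ∈ W (c + d) := by
  rcases Nat.eq_zero_or_pos c with rfl | hc
  · rw [WS_d0 hv]; simp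
  rcases Nat.eq_zero_or_pos d with rfl | hd
  · rw [WS_d0 hw]; simp
  obtain ⟨hv1, hv2, e, he, hev⟩ := hv
  obtain ⟨hw1, hw2, f, hf, hfw⟩ := hw
  have hp := WS_one_mem hv1 hev
  have hq := WS_one_mem hw1 hfw
  refine ⟨?_, ?_, e * f * e⁻¹ * f⁻¹, EE.mul_mem (EE.mul_mem (EE.mul_mem he hf) (EE.inv_mem he))
    (EE.inv_mem hf), ?_⟩
  · intro u hu
    rw [NC.sub_apply, hv1.mul hw1 u hu, hw1.mul hv1 u (by omega), sub_zero]
  · rw [NC.sub_apply, NC.mul_nil, NC.mul_nil, hv2, hw2]; simp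
  · have key : (((e * f * e⁻¹ * f⁻¹ : NCˣ)) : NC) - 1 - (v * w - w * v) =
      (((e : NC) - 1) * ((f : NC) - 1) - ((f : NC) - 1) * ((e : NC) - 1)) *
          (((e⁻¹ : NCˣ) : NC) * (((f⁻¹ : NCˣ) : NC) - 1) + (((e⁻¹ : NCˣ) : NC) - 1))
        + ((((e : NC) - 1 - v) * ((f : NC) - 1) - ((f : NC) - 1) * ((e : NC) - 1 - v))
        + (v * ((f : NC) - 1 - w) - ((f : NC) - 1 - w) * v)) := by
      have h1 : (((e * f * e⁻¹ * f⁻¹ : NCˣ)) : NC) - 1 =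
        ((e : NC) * f - f * e) * (((e⁻¹ : NCˣ) : NC) * ((f⁻¹ : NCˣ) : NC)) := by
        rw [sub_mul]
        have : (f : NC) * e * (((e⁻¹ : NCˣ) : NC) * ((f⁻¹ : NCˣ) : NC)) = 1 := by
          rw [mul_assoc, ← mul_assoc (e : NC), Units.mul_inv, one_mul, Units.mul_inv]
        rw [this]
        simp only [Units.val_mul, mul_assoc]
      rw [h1]
      noncomm_ring
    rw [key]
    have hbr : (((e : NC) - 1) * ((f : NC) - 1) - ((f : NC) - 1) * ((e : NC) - 1)) ∈ Idl (c + d) :=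
      Submodule.sub_mem _ (Idl_mul hp hq) (by rw [add_comm]; exact Idl_mul hq hp)
    have hi : (((e⁻¹ : NCˣ) : NC) * (((f⁻¹ : NCˣ) : NC) - 1) + (((e⁻¹ : NCˣ) : NC) - 1)) ∈ Idl 1 :=
      Submodule.add_mem _ (Idl_mul_left _ (inv_sub_one_mem f (Idl_mono hd hq)))
        (inv_sub_one_mem e (Idl_mono hc hp))
    refine Submodule.add_mem _ (Idl_mul hbr hi) (Submodule.add_mem _ (Submodule.sub_mem _ ?_ ?_)
      (Submodule.sub_mem _ ?_ ?_))
    · exact Idl_mono (by omega) (Idl_mul hev hq)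
    · exact Idl_mono (by omega) (Idl_mul hq hev)
    · exact Idl_mono (by omega) (Idl_mul hv1.idl hfw)
    · exact Idl_mono (by omega) (Idl_mul hfw hv1.idl)

theorem tt_mem {n : ℕ} (hn : 1 ≤ n) : tt n ∈ W (n + 1) := by
  refine ⟨tt_hom n, by simp [tt], exU n 1, exU_mem hn 1, ?_⟩
  intro w hw
  show ex n 1 w - (1 : NC) w - tt n w = 0
  match w with
  | [] => simp [ex, emb, NC.one_nil, tt]
  | [i] => by_cases h : i = n <;> simp [ex, emb, NC.one_cons, tt, h]
  | i :: j :: l =>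
    have : ¬ (∀ k ∈ i :: j :: l, k = n) := by
      intro h
      simp only [wt_cons] at hw
      have := h i (by simp)
      have := h j (by simp)
      omega
    rw [ex, emb, if_neg this, NC.one_cons, tt]; simp

theorem finite_words (d : ℕ) : {w : List ℕ | wt w = d}.Finite := by
  induction d using Nat.strong_induction_on with
  | _ d ih =>
    have : {w : List ℕ | wt w = d} ⊆
        {[]} ∪ ⋃ i ∈ Finset.range d, (fun l => i :: l) '' {w : List ℕ | wt w = d - 1 - i} := by
      intro w hw
      cases w with
      | nil => simp
      | cons i l =>
        have hw' : wt (i :: l) = d := hw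
        rw [wt_cons] at hw'
        right
        simp only [Set.mem_iUnion]
        refine ⟨i, by simp; omega, l, ?_, rfl⟩
        show wt l = _
        omega
    refine Set.Finite.subset (Set.Finite.union (Set.finite_singleton _) ?_) this
    refine Set.Finite.biUnion (Finset.finite_toSet _) fun i hi => Set.Finite.image _ (ih _ ?_)
    have : i < d := by simpa using hi
    omega

def single (w : List ℕ) : NC := fun u => if u = w then 1 else 0

theorem hom_sum {d : ℕ} {f : NC} (h : Hom d f) :
    f = ∑ w ∈ (finite_words d).toFinset, f w • single w := by
  apply NC.ext; intro u
  have hs : ∀ (s : Finset (List ℕ)) (F : List ℕ → NC), (∑ k ∈ s, F k) u = ∑ k ∈ s, F k u := fun s F =>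
    Finset.sum_apply (M := fun _ : List ℕ => ℂ) u s F
  rw [hs]
  simp only [NC.smul_apply, single]
  simp only [mul_ite, mul_one, mul_zero]
  refine Eq.trans ?_ (Finset.sum_ite_eq _ u (f : List ℕ → ℂ)).symm
  split_ifs with h1
  · rfl
  · apply h; simpa using h1

theorem W_integral {d : ℕ} (F : ℝ → NC) (hF : ∀ s, F s ∈ W d)
    (hi : ∀ w, LB (fun s => F s w)) (x : ℝ) (v : NC)
    (hv : ∀ w, v w = ∫ s in (0:ℝ)..x, F s w) : v ∈ W d := by
  by_contra hn
  obtain ⟨φ, hφv, hφ⟩ := Submodule.exists_le_ker_of_notMem hn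
  have hvh : Hom d v := by
    intro w hw
    rw [hv]
    simp [(hF _).1 w hw]
  apply hφv
  have h1 : ∀ f : NC, Hom d f → φ f = ∑ w ∈ (finite_words d).toFinset, f w * φ (single w) := by
    intro f hf
    conv_lhs => rw [hom_sum hf, map_sum]
    simp
  rw [h1 v hvh]
  have h2 : ∀ s, ∑ w ∈ (finite_words d).toFinset, F s w * φ (single w) = 0 := by
    intro s
    rw [← h1 _ (hF s).1]
    exact hφ (hF s)
  simp only [hv]
  simp only [← intervalIntegral.integral_mul_const]
  rw [← intervalIntegral.integral_finsetSum]
  · simp [h2]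
  · intro w _
    exact ((hi w).mul (LB.const _)).intInt 0 x
def Good (a : ℕ → ℝ → ℂ) : Prop :=
  (∀ i, Measurable (a i) ∧ ∃ C : ℝ, ∀ x, ‖a i x‖ ≤ C) ∧ ∀ x, a 0 x = 0

theorem Good.lb {a : ℕ → ℝ → ℂ} (h : Good a) (i : ℕ) : LB (a i) := by
  obtain ⟨h1, C, hC⟩ := h.1 i
  exact ⟨h1, fun R => ⟨C, fun x _ => hC x⟩⟩

def hh (a : ℕ → ℝ → ℂ) (x : ℝ) : NC := fun w => itIntAux a w x

def AA (a : ℕ → ℝ → ℂ) (x : ℝ) : NC := lin (fun i => a i x)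
def BB (a : ℕ → ℝ → ℂ) (x : ℝ) : NC := lin (fun i => ((i : ℂ) + 1) * a i x)

theorem hh_nil (a : ℕ → ℝ → ℂ) (x : ℝ) : hh a x [] = 1 := rfl
theorem hh_cons (a : ℕ → ℝ → ℂ) (x : ℝ) (i : ℕ) (l : List ℕ) :
    hh a x (i :: l) = ∫ s in (0 : ℝ)..x, a i s * hh a s l := rfl

theorem hh_zero (a : ℕ → ℝ → ℂ) : hh a 0 = 1 := by
  apply NC.ext; intro w
  cases w with
  | nil => rfl
  | cons i l => rw [hh_cons, NC.one_cons, intervalIntegral.integral_same]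

theorem hh_HI {a : ℕ → ℝ → ℂ} (h : Good a) (w : List ℕ) :
    HI (fun x => hh a x w) (fun x => (AA a x * hh a x) w) := by
  induction w with
  | nil =>
    simp only [AA, lin_mul_nil, hh_nil]
    exact HI.const 1
  | cons i l ih =>
    simp only [AA, lin_mul_cons]
    refine ⟨(h.lb i).mul (LB.of_cont ih.cont), fun x => ?_⟩
    simp only [hh_cons]
    simp

theorem mul_HI {f f' g g' : ℝ → NC} (hf : ∀ w, HI (fun x => f x w) (fun x => f' x w))
    (hg : ∀ w, HI (fun x => g x w) (fun x => g' x w)) (w : List ℕ) :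
    HI (fun x => (f x * g x) w) (fun x => (f' x * g x + f x * g' x) w) := by
  induction w generalizing f f' with
  | nil =>
    simp only [NC.mul_nil, NC.add_apply]
    exact (hf []).mul (hg [])
  | cons i l ih =>
    have h1 := ih (f := fun x => sh i (f x)) (f' := fun x => sh i (f' x)) (fun w => hf (i :: w))
    have h2 := ((hf []).mul (hg (i :: l))).add h1
    simp only [NC.mul_cons, NC.add_apply] at h2 ⊢
    convert h2 using 2
    ring

def yy (a : ℕ → ℝ → ℂ) : List ℕ → ℝ → ℂ
  | [], _ => 0
  | i :: l, x => ∫ s in (0 : ℝ)..x, (BB a s (i :: l) + a i s * yy a l s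
      - yy a ((i :: l).dropLast) s * a ((i :: l).getLast (by simp)) s)
  termination_by w => w.length
  decreasing_by all_goals simp

def yv (a : ℕ → ℝ → ℂ) (x : ℝ) : NC := fun w => yy a w x

def GG (a : ℕ → ℝ → ℂ) (x : ℝ) : NC := BB a x + AA a x * yv a x - yv a x * AA a x

theorem yv_nil (a : ℕ → ℝ → ℂ) (x : ℝ) : yv a x [] = 0 := by
  show yy a [] x = 0
  rw [yy]

theorem yv_eq (a : ℕ → ℝ → ℂ) (x : ℝ) (w : List ℕ) :
    yv a x w = ∫ s in (0 : ℝ)..x, GG a s w := by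
  cases w with
  | nil =>
    rw [yv_nil]
    have : ∀ s, GG a s [] = 0 := by
      intro s
      rw [GG, NC.sub_apply, NC.add_apply, AA, lin_mul_nil, mul_lin_nil]
      simp [BB, lin]
    simp [this]
  | cons i l =>
    show yy a (i :: l) x = _
    rw [yy]
    congr 1
    ext s
    rw [GG, NC.sub_apply, NC.add_apply, AA, lin_mul_cons]
    have : (yv a s * lin fun i => a i s) (i :: l) =
        (yv a s * lin fun i => a i s) ((i :: l).dropLast ++ [(i :: l).getLast (by simp)]) := by
      rw [List.dropLast_append_getLast]
    rw [this, mul_lin_concat]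
    rfl

theorem lin_LB {β : ℕ → ℝ → ℂ} (h : ∀ i, LB (β i)) (w : List ℕ) :
    LB (fun s => lin (fun i => β i s) w) := by
  match w with
  | [] => exact LB.const 0
  | [i] => exact h i
  | i :: j :: l => exact LB.const 0

theorem yv_HI {a : ℕ → ℝ → ℂ} (h : Good a) (w : List ℕ) :
    HI (fun x => yv a x w) (fun x => GG a x w) := by
  induction hn : w.length using Nat.strong_induction_on generalizing w with
  | _ n ih =>
    refine ⟨?_, fun x => by
      show yv a x w = yv a 0 w + ∫ s in (0:ℝ)..x, GG a s w
      rw [yv_eq a x, yv_eq a 0, intervalIntegral.integral_same, zero_add]⟩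
    have hb : LB (fun s => BB a s w) := lin_LB (fun i => (LB.const _).mul (h.lb i)) w
    have h1 : LB (fun s => (AA a s * yv a s) w) := by
      cases w with
      | nil => simp only [AA, lin_mul_nil]; exact LB.const 0
      | cons i l =>
        simp only [AA, lin_mul_cons]
        exact (h.lb i).mul (LB.of_cont (ih l.length (by simp at hn; omega) l rfl).cont)
    have h2 : LB (fun s => (yv a s * AA a s) w) := by
      rcases List.eq_nil_or_concat w with rfl | ⟨l, i, rfl⟩
      · simp only [AA, mul_lin_nil]; exact LB.const 0
      · simp only [AA, List.concat_eq_append, mul_lin_concat]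
        exact (LB.of_cont (ih l.length (by simp at hn; omega) l rfl).cont).mul (h.lb i)
    exact (hb.add h1).sub h2

theorem comp_one (d : ℕ) : comp d (1 : NC) = if d = 0 then 1 else 0 := by
  apply NC.ext; intro w
  cases w with
  | nil => by_cases h : d = 0 <;> simp [comp, wt_nil, h, NC.one_nil, NC.zero_apply, eq_comm]
  | cons i l => by_cases h : d = 0 <;> simp [comp, h, NC.one_cons, NC.zero_apply]

theorem comp_yv_mem {a : ℕ → ℝ → ℂ} (h : Good a) (d : ℕ) (x : ℝ) : comp d (yv a x) ∈ W d := by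
  induction d using Nat.strong_induction_on generalizing x with
  | _ d ih =>
    refine W_integral (fun s => comp d (GG a s)) (fun s => ?_) (fun w => ?_) x _ (fun w => ?_)
    · have e1 : comp d (GG a s) = comp d (BB a s * 1) +
          (comp d (AA a s * yv a s) - comp d (yv a s * AA a s)) := by
        apply NC.ext; intro w
        rw [NC.add_apply, NC.sub_apply, mul_one]
        by_cases hw : wt w = d
        · simp only [comp, hw, if_true, GG, NC.sub_apply, NC.add_apply]; ring
        · simp [comp, hw]
      rw [e1]
      refine Submodule.add_mem _ ?_ ?_
      · rw [BB, comp_lin_mul]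
        refine Submodule.sum_mem _ fun k hk => ?_
        have hk' : k < d := by simpa using hk
        rw [comp_one]
        split_ifs with hd
        · rcases Nat.eq_zero_or_pos k with rfl | hk0
          · simp [h.2]
          · rw [mul_one]
            apply Submodule.smul_mem
            have := tt_mem hk0
            rwa [show k + 1 = d by omega] at this
        · simp
      · rw [AA, comp_lin_mul, comp_mul_lin, ← Finset.sum_sub_distrib]
        refine Submodule.sum_mem _ fun k hk => ?_
        have hk' : k < d := by simpa using hk
        rw [← smul_sub]
        rcases Nat.eq_zero_or_pos k with rfl | hk0
        · rw [h.2, zero_smul]; exact Submodule.zero_mem _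
        · apply Submodule.smul_mem
          have := W_bracket (tt_mem hk0) (ih (d - 1 - k) (by omega) s)
          rwa [show k + 1 + (d - 1 - k) = d by omega] at this
    · by_cases hw : wt w = d
      · simp only [comp, hw, if_true]; exact (yv_HI h w).1
      · simp only [comp, hw, if_false]; exact LB.const 0
    · by_cases hw : wt w = d
      · simp only [comp, hw, if_true]; exact yv_eq a x w
      · simp [comp, hw]

theorem yv_mul_hh {a : ℕ → ℝ → ℂ} (h : Good a) (x : ℝ) (w : List ℕ) :
    (yv a x * hh a x) w = (wt w : ℂ) * hh a x w := by
  induction w generalizing x with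
  | nil => simp [NC.mul_nil, yv_nil, wt_nil]
  | cons i l ih =>
    have h1 := (mul_HI (yv_HI h) (hh_HI h) (i :: l)).2 x
    have h0 : yv a 0 = 0 := NC.ext fun w => by rw [yv_eq]; simp [NC.zero_apply]
    have h2 : ∀ s, (GG a s * hh a s + yv a s * (AA a s * hh a s)) (i :: l) =
        (wt (i :: l) : ℂ) * (a i s * hh a s l) := by
      intro s
      have : GG a s * hh a s + yv a s * (AA a s * hh a s) =
        BB a s * hh a s + AA a s * (yv a s * hh a s) := by
        rw [GG]; noncomm_ring
      rw [this, NC.add_apply, BB, AA, lin_mul_cons, lin_mul_cons, ih, wt_cons]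
      push_cast; ring
    simp only [h2, h0, zero_mul, NC.zero_apply, zero_add] at h1
    rw [h1, intervalIntegral.integral_const_mul, hh_cons]

theorem leading {a : ℕ → ℝ → ℂ} (h : Good a) (T : ℝ) {d : ℕ} (hd : 1 ≤ d)
    (hI : hh a T - 1 ∈ Idl d) : comp d (hh a T) ∈ W d := by
  have h1 : yv a T ∈ Idl 1 := by
    intro w hw
    rw [wt_eq_zero (by omega : wt w = 0), yv_nil]
  have h2 := Idl_mul h1 hI
  have h3 : comp d (hh a T) = (d : ℂ)⁻¹ • comp d (yv a T) := by
    apply NC.ext; intro w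
    rw [NC.smul_apply]
    by_cases hw : wt w = d
    · simp only [comp, hw, if_true]
      have h4 := h2 w (by omega)
      rw [mul_sub, mul_one, NC.sub_apply, yv_mul_hh h, hw] at h4
      have : (d : ℂ) ≠ 0 := by exact_mod_cast (by omega : d ≠ 0)
      field_simp
      linear_combination h4
    · simp [comp, hw]
  rw [h3]
  exact Submodule.smul_mem _ _ (comp_yv_mem h d T)

theorem star_good {T : ℝ} {a b : ℕ → ℝ → ℂ} (ha : Good a) (hb : Good b) :
    Good (starProd T a b) := by
  refine ⟨fun i => ⟨?_, ?_⟩, fun x => ?_⟩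
  · unfold starProd
    refine Measurable.ite measurableSet_Iic ?_ ?_
    · exact ((hb.1 i).1.comp (measurable_const_mul 2)).const_mul 2
    · exact ((ha.1 i).1.comp ((measurable_const_mul 2).sub_const T)).const_mul 2
  · obtain ⟨C, hC⟩ := (ha.1 i).2
    obtain ⟨D, hD⟩ := (hb.1 i).2
    refine ⟨2 * max C D, fun x => ?_⟩
    unfold starProd
    split_ifs
    · rw [norm_mul]; simpa using Or.inr (hD _)
    · rw [norm_mul]; simpa using Or.inl (hC _)
  · simp [starProd, ha.2, hb.2]

theorem chen1 {T : ℝ} {a b : ℕ → ℝ → ℂ} (w : List ℕ) (x : ℝ) (h0 : 0 ≤ x) (hx : x ≤ T / 2) :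
    hh (starProd T a b) x w = hh b (2 * x) w := by
  induction w generalizing x with
  | nil => rfl
  | cons i l ih =>
    rw [hh_cons, hh_cons]
    have : ∫ s in (0:ℝ)..x, starProd T a b i s * hh (starProd T a b) s l =
        ∫ s in (0:ℝ)..x, (2:ℂ) * (fun u => b i u * hh b u l) (2 * s) := by
      apply intervalIntegral.integral_congr
      intro s hs
      rw [Set.uIcc_of_le h0] at hs
      have hs2 : s ≤ T / 2 := hs.2.trans hx
      beta_reduce
      rw [ih s hs.1 hs2, starProd, if_pos hs2]; ring
    rw [this, intervalIntegral.integral_const_mul,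
      intervalIntegral.integral_comp_mul_left (fun u => b i u * hh b u l) (two_ne_zero)]
    simp

theorem chen2 {T : ℝ} (hT : 0 < T) {a b : ℕ → ℝ → ℂ} (ha : Good a) (hb : Good b)
    (w : List ℕ) (x : ℝ) (hx : T / 2 ≤ x) :
    hh (starProd T a b) x w = (hh a (2 * x - T) * hh b T) w := by
  induction w generalizing x with
  | nil => simp [NC.mul_nil, hh_nil]
  | cons i l ih =>
    have hs := star_good (T := T) ha hb
    have hL : LB (fun s => starProd T a b i s * hh (starProd T a b) s l) :=
      (hs.lb i).mul (LB.of_cont (hh_HI hs l).cont)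
    have h1 := (mul_HI (hh_HI ha) (g := fun _ => hh b T) (g' := fun _ => 0)
      (fun w => HI.const _) (i :: l)).2 (2 * x - T)
    simp only [hh_zero, one_mul, mul_zero, add_zero, mul_assoc] at h1
    rw [h1, hh_cons, ← intervalIntegral.integral_add_adjacent_intervals (hL.intInt 0 (T/2))
      (hL.intInt (T/2) x)]
    congr 1
    · have := chen1 (T := T) (a := a) (b := b) (i :: l) (T / 2) (by linarith) le_rfl
      rw [hh_cons] at this
      rw [this]; congr 1; ring
    · have h2 : ∫ s in (T/2)..x, starProd T a b i s * hh (starProd T a b) s l =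
          ∫ s in (T/2)..x, (2:ℂ) * (fun u => a i u * (hh a u * hh b T) l) (2 * s - T) := by
        apply intervalIntegral.integral_congr_ae
        refine Filter.Eventually.of_forall fun s hs => ?_
        rw [Set.uIoc_of_le hx] at hs
        beta_reduce
        rw [ih s hs.1.le, starProd, if_neg (not_le.2 hs.1)]; ring
      rw [h2, intervalIntegral.integral_const_mul,
        intervalIntegral.integral_comp_mul_sub (fun u => a i u * (hh a u * hh b T) l) (two_ne_zero)]
      simp only [AA, lin_mul_cons]
      rw [show 2 * (T / 2) - T = 0 by ring]
      simp

theorem chen {T : ℝ} (hT : 0 < T) {a b : ℕ → ℝ → ℂ} (ha : Good a) (hb : Good b) :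
    hh (starProd T a b) T = hh a T * hh b T := by
  apply NC.ext; intro w
  rw [chen2 hT ha hb w T (by linarith), show 2 * T - T = T by ring]

def el (n : ℕ) (c : ℂ) : ℕ → ℝ → ℂ := fun j _ => if j = n then c else 0

theorem el_good {n : ℕ} (hn : 1 ≤ n) (c : ℂ) : Good (el n c) := by
  refine ⟨fun i => ⟨measurable_const, ‖c‖, fun x => ?_⟩, fun x => ?_⟩
  · unfold el; split_ifs <;> simp
  · unfold el; rw [if_neg (by omega)]

theorem el_elem {n : ℕ} (hn : 1 ≤ n) (c : ℂ) : ElemRect (el n c) :=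
  ⟨n, hn, c, fun x => by simp [el], fun j hj x => by simp [el, hj]⟩

theorem hh_el (n : ℕ) (c : ℂ) (x : ℝ) : hh (el n c) x = ex n (c * x) := by
  apply NC.ext; intro w
  induction w generalizing x with
  | nil => simp [hh_nil, ex, emb]
  | cons i l ih =>
    rw [hh_cons]
    simp only [ih]
    by_cases hi : i = n
    · subst hi
      by_cases hl : ∀ j ∈ l, j = i
      · have hl' : ∀ j ∈ i :: l, j = i := by simpa using hl
        simp only [ex, emb, if_pos hl, if_pos hl', el, if_true]
        have hd : ∀ s ∈ Set.uIcc 0 x, HasDerivAt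
            (fun s : ℝ => (c * s) ^ (i :: l).length / (((i :: l).length.factorial : ℕ) : ℂ))
            (c * ((c * s) ^ l.length / ((l.length.factorial : ℕ) : ℂ))) s := by
          intro s _
          have h1 : HasDerivAt (fun s : ℝ => c * (s : ℂ)) c s := by
            simpa using (Complex.ofRealCLM.hasDerivAt (x := s)).const_mul c
          have h2 := (h1.pow (l.length + 1)).div_const (((l.length + 1).factorial : ℕ) : ℂ)
          refine HasDerivAt.congr_deriv h2 ?_
          rw [Nat.factorial_succ]
          have : ((l.length.factorial : ℕ) : ℂ) ≠ 0 := by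
            exact_mod_cast Nat.factorial_ne_zero _
          have h3 : ((l.length : ℂ) + 1) ≠ 0 := Nat.cast_add_one_ne_zero l.length
          push_cast
          field_simp
          try simp
        rw [intervalIntegral.integral_eq_sub_of_hasDerivAt hd]
        · simp
        · apply Continuous.intervalIntegrable
          fun_prop
      · have hl' : ¬ ∀ j ∈ i :: l, j = i := by simpa using hl
        simp [ex, emb, if_neg hl, if_neg hl']
    · simp [el, ex, emb, hi]

theorem fold_good {T : ℝ} (L : List (ℕ × ℂ)) (hL : ∀ p ∈ L, 1 ≤ p.1) (f : ℕ → ℝ → ℂ) (hf : Good f) :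
    Good ((L.map fun p => el p.1 p.2).foldl (starProd T) f) := by
  induction L generalizing f with
  | nil => exact hf
  | cons p L ih =>
    exact ih (fun q hq => hL q (by simp [hq])) _ (star_good hf (el_good (hL p (by simp)) _))

theorem fold_hh {T : ℝ} (hT : 0 < T) (L : List (ℕ × ℂ)) (hL : ∀ p ∈ L, 1 ≤ p.1) (f : ℕ → ℝ → ℂ)
    (hf : Good f) :
    hh ((L.map fun p => el p.1 p.2).foldl (starProd T) f) T =
      hh f T * (L.map fun p => ex p.1 (p.2 * T)).prod := by
  induction L generalizing f with
  | nil => simp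
  | cons p L ih =>
    have h1 := el_good (hL p (by simp)) p.2
    have := ih (fun q hq => hL q (by simp [hq])) _ (star_good (T := T) hf h1)
    simp only [List.map_cons, List.foldl_cons, List.prod_cons]
    rw [this, chen hT hf h1, hh_el, mul_assoc]

theorem EE_path {T : ℝ} (hT : 0 < T) {e : NCˣ} (he : e ∈ EE) :
    ∃ (f : ℕ → ℝ → ℂ) (L : List (ℕ → ℝ → ℂ)), ElemRect f ∧ (∀ g ∈ L, ElemRect g) ∧
      Good (L.foldl (starProd T) f) ∧ hh (L.foldl (starProd T) f) T = (e : NC) := by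
  obtain ⟨L, hL, h⟩ := EE_list he
  have hL' : ∀ p ∈ L.map (fun p => (p.1, p.2 / (T : ℂ))), 1 ≤ p.1 := by
    intro p hp
    obtain ⟨q, hq, rfl⟩ := List.mem_map.1 hp
    exact hL q hq
  have hTc : (T : ℂ) ≠ 0 := by exact_mod_cast hT.ne'
  refine ⟨el 1 0, (L.map (fun p => (p.1, p.2 / (T : ℂ)))).map (fun p => el p.1 p.2),
    el_elem le_rfl 0, ?_, fold_good _ hL' _ (el_good le_rfl 0), ?_⟩
  · intro g hg
    obtain ⟨p, hp, rfl⟩ := List.mem_map.1 hg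
    exact el_elem (hL' p hp) _
  · rw [fold_hh hT _ hL' _ (el_good le_rfl 0), hh_el, zero_mul, ex_zero, one_mul, h, List.map_map]
    congr 2
    ext p
    simp [hTc]

theorem approx {T : ℝ} (hT : 0 < T) {a : ℕ → ℝ → ℂ} (ha : Good a) (d : ℕ) :
    ∃ e ∈ EE, hh a T - ((e : NCˣ) : NC) ∈ Idl (d + 1) := by
  induction d with
  | zero =>
    refine ⟨1, EE.one_mem, fun w hw => ?_⟩
    rw [wt_eq_zero (by omega : wt w = 0), NC.sub_apply, hh_nil, Units.val_one, NC.one_nil, sub_self]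
  | succ d ih =>
    obtain ⟨e, he, h⟩ := ih
    obtain ⟨f, L, _, _, hg, hb⟩ := EE_path hT (EE.inv_mem he)
    have hs := star_good (T := T) hg ha
    have hc := chen hT hg ha
    rw [hb] at hc
    have h1 : hh (starProd T (L.foldl (starProd T) f) a) T - 1 ∈ Idl (d + 1) := by
      rw [hc]
      have := Idl_mul_left ((e⁻¹ : NCˣ) : NC) h
      rwa [mul_sub, Units.inv_mul] at this
    obtain ⟨_, _, e', he', h2⟩ := leading hs T (by omega) h1
    have h3 := sub_comp_mem h1
    rw [hc] at h2 h3
    have h4 : comp (d + 1) (((e⁻¹ : NCˣ) : NC) * hh a T - 1) =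
        comp (d + 1) (((e⁻¹ : NCˣ) : NC) * hh a T) := by
      apply NC.ext; intro w
      unfold comp
      split_ifs with hw
      · cases w with
        | nil => rw [wt_nil] at hw; omega
        | cons i l => rw [NC.sub_apply, NC.one_cons, sub_zero]
      · rfl
    rw [h4] at h3
    refine ⟨e * e', EE.mul_mem he he', ?_⟩
    have h5 := Idl_mul_left (e : NC) (Submodule.sub_mem _ h3 h2)
    convert h5 using 1
    rw [Units.val_mul]
    simp only [mul_sub, ← mul_assoc, Units.mul_inv]
    simp only [one_mul]
    abel

open Classical in
theorem trunc_eq {T : ℝ} (a : ℕ → ℝ → ℂ) (w : List ℕ) (hw : ∀ i ∈ w, 1 ≤ i) (x : ℝ)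
    (hx : x ∈ Set.Icc (0:ℝ) T) :
    itIntAux (fun i x => if 1 ≤ i then (Set.Icc (0:ℝ) T).indicator (a i) x else 0) w x
      = itIntAux a w x := by
  induction w generalizing x with
  | nil => rfl
  | cons i l ih =>
    rw [itIntAux, itIntAux]
    apply intervalIntegral.integral_congr
    intro s hs
    rw [Set.uIcc_of_le hx.1] at hs
    have hs' : s ∈ Set.Icc (0:ℝ) T := ⟨hs.1, hs.2.trans hx.2⟩
    beta_reduce
    rw [ih (fun j hj => hw j (by simp [hj])) s hs', if_pos (hw i (by simp)),
      Set.indicator_of_mem hs']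

/-- approximation by rectangular paths: for every `a ∈ X` and `N ≥ 1`
there is a finite `*`-product `b` of elementary rectangular elements whose basic iterated
integrals agree with those of `a` for all multi-indices with `i₁+⋯+iₖ ≤ N`. -/
theorem rectangular_approximation (T : ℝ) (hT : 0 < T) (a : ℕ → ℝ → ℂ) (ha : MemX T a)
    (N : ℕ) (hN : 1 ≤ N) :
    ∃ (e : ℕ → ℝ → ℂ) (L : List (ℕ → ℝ → ℂ)),
      ElemRect e ∧ (∀ g ∈ L, ElemRect g) ∧
      ∀ l : List ℕ, (∀ i ∈ l, 1 ≤ i) → l.sum ≤ N →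
        itInt T (L.foldl (starProd T) e) l = itInt T a l := by
  obtain ⟨hm, C, hC⟩ := ha
  have hg : Good (fun i x => if 1 ≤ i then (Set.Icc (0:ℝ) T).indicator (a i) x else 0) := by
    refine ⟨fun i => ⟨?_, ?_⟩, fun x => by simp⟩
    · by_cases hi : 1 ≤ i
      · simp only [hi, if_true]; exact (hm i).indicator measurableSet_Icc
      · simp only [hi, if_false]; exact measurable_const
    · by_cases hi : 1 ≤ i
      · refine ⟨C ^ i, fun x => ?_⟩
        simp only [hi, if_true]
        by_cases hx : x ∈ Set.Icc (0:ℝ) T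
        · rw [Set.indicator_of_mem hx]; exact hC i hi x hx
        · rw [Set.indicator_of_notMem hx, norm_zero]
          exact (norm_nonneg _).trans (hC i hi 0 ⟨le_rfl, hT.le⟩)
      · exact ⟨0, fun x => by simp [hi]⟩
  obtain ⟨e, he, h⟩ := approx hT hg (2 * N)
  obtain ⟨f, L, hf, hL, _, hb⟩ := EE_path hT he
  refine ⟨f, L, hf, hL, fun l hl hs => ?_⟩
  have hr : ∀ i ∈ l.reverse, 1 ≤ i := by simpa using hl
  have hlen : l.length ≤ l.sum := by
    have := List.card_nsmul_le_sum l 1 hl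
    simpa using this
  have hw : wt l.reverse < 2 * N + 1 := by
    simp only [wt, List.sum_reverse, List.length_reverse]; omega
  have h1 := h _ hw
  rw [← hb, NC.sub_apply, sub_eq_zero] at h1
  unfold itInt
  rw [← trunc_eq a l.reverse hr T ⟨hT.le, le_rfl⟩]
  exact h1.symm
end
end

section
/- (Composition of first return maps.) For all a,b ∈ X there exists ε>0 such that for every r ∈ ℂ with |r|<ε the Lipschitz solutions v(·;r;b), v(·;v(T;r;b);a) and v(·;r;a*b) all exist on I_T and v(T;r;a*b) = v(T; v(T;r;b); a). -/
open MeasureTheory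

noncomputable section

/-- `v` is a Lipschitz solution on `[0,T]` of `v' = ∑_{i≥1} aᵢ(x) v^{i+1}`:
`v` is Lipschitz on `[0,T]` and for a.e. `x ∈ [0,T]` the series
`∑_{i≥1} aᵢ(x) v(x)^{i+1}` converges absolutely and is the derivative of `v` at `x`. -/
def IsODESol (T : ℝ) (a : ℕ → ℝ → ℂ) (v : ℝ → ℂ) : Prop :=
  (∃ K : NNReal, LipschitzOnWith K v (Set.Icc 0 T)) ∧
    ∀ᵐ x ∂(volume.restrict (Set.Icc (0 : ℝ) T)),
      (Summable fun i : ℕ => ‖a (i + 1) x * v x ^ (i + 2)‖) ∧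
        HasDerivAt v (∑' i : ℕ, a (i + 1) x * v x ^ (i + 2)) x

def odeF (a : ℕ → ℝ → ℂ) (x : ℝ) (z : ℂ) : ℂ := ∑' i : ℕ, a (i + 1) x * z ^ (i + 2)

lemma lip_int {p q M : ℝ} (hpq : p ≤ q) {g : ℝ → ℂ} (hint : IntervalIntegrable g volume p q)
    (hb : ∀ᵐ x, x ∈ Set.Icc p q → ‖g x‖ ≤ M) :
    LipschitzOnWith M.toNNReal (fun x => ∫ t in p..x, g t) (Set.Icc p q) := by
  refine LipschitzOnWith.of_dist_le' fun x hx y hy => ?_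
  have hsx : IntervalIntegrable g volume p x :=
    hint.mono_set (Set.uIcc_subset_uIcc (by simp) (by rwa [Set.uIcc_of_le hpq]))
  have hsy : IntervalIntegrable g volume p y :=
    hint.mono_set (Set.uIcc_subset_uIcc (by simp) (by rwa [Set.uIcc_of_le hpq]))
  rw [dist_eq_norm, intervalIntegral.integral_interval_sub_left hsx hsy, Real.dist_eq]
  refine intervalIntegral.norm_integral_le_of_norm_le_const_ae ?_
  filter_upwards [hb] with t ht htm
  refine ht ?_
  have h1 := Set.uIoc_subset_uIcc htm
  exact (Set.uIcc_subset_Icc hy hx) h1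

lemma mvt_aux {p q M : ℝ} (hpq : p ≤ q) {f : ℝ → ℂ} {K : NNReal}
    (hf : LipschitzOnWith K f (Set.Icc p q))
    (hd : ∀ᵐ x, x ∈ Set.Icc p q → ∃ d, HasDerivAt f d x ∧ ‖d‖ ≤ M) :
    ‖f q - f p‖ ≤ M * (q - p) := by
  have hb : ∀ᵐ x, x ∈ Set.Icc p q → ‖deriv f x‖ ≤ M := by
    filter_upwards [hd] with x hx hxm
    obtain ⟨d, h1, h2⟩ := hx hxm
    rwa [h1.deriv]
  have hint : IntervalIntegrable (deriv f) volume p q := by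
    rw [intervalIntegrable_iff_integrableOn_Icc_of_le hpq]
    refine Measure.integrableOn_of_bounded (M := M) (by simp) (measurable_deriv f).aestronglyMeasurable ?_
    rwa [ae_restrict_iff' measurableSet_Icc]
  have hac : AbsolutelyContinuousOnInterval f p q :=
    LipschitzOnWith.absolutelyContinuousOnInterval (by rwa [Set.uIcc_of_le hpq])
  have hac2 : AbsolutelyContinuousOnInterval (fun x => ∫ t in p..x, deriv f t) p q :=
    LipschitzOnWith.absolutelyContinuousOnInterval (K := M.toNNReal) (by
      rw [Set.uIcc_of_le hpq]; exact lip_int hpq hint hb)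
  have h0 : ∀ᵐ x, x ∈ Set.uIcc p q → HasDerivAt (fun x => f x - ∫ t in p..x, deriv f t) 0 x := by
    filter_upwards [hd, hint.ae_hasDerivAt_integral] with x h1 h2 h3
    obtain ⟨d, h4, -⟩ := h1 (by rwa [Set.uIcc_of_le hpq] at h3)
    have := h4.sub (h2 h3 p (by simp))
    rw [h4.deriv, sub_self] at this
    exact this
  obtain ⟨C, hC⟩ := (hac.sub hac2).const_of_ae_hasDerivAt_zero h0
  have e1 := hC p (by simp)
  have e2 := hC q (by simp)
  simp only [Pi.sub_apply, intervalIntegral.integral_same, sub_zero] at e1 e2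
  have e3 : f q - f p = ∫ t in p..q, deriv f t := by rw [e1, ← e2]; ring
  rw [e3]
  have := intervalIntegral.norm_integral_le_of_norm_le_const_ae (a := p) (b := q) (C := M) (f := deriv f) (by
    filter_upwards [hb] with x hx hxm
    rw [Set.uIoc_of_le hpq] at hxm
    exact hx ⟨hxm.1.le, hxm.2⟩)
  rwa [abs_of_nonneg (by linarith)] at this

lemma pow_sub_le {R : ℝ} {z w : ℂ} (hz : ‖z‖ ≤ R) (hw : ‖w‖ ≤ R) (n : ℕ) :
    ‖z ^ (n + 1) - w ^ (n + 1)‖ ≤ (n + 1) * R ^ n * ‖z - w‖ := by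
  have hR : 0 ≤ R := (norm_nonneg _).trans hz
  induction n with
  | zero => simp
  | succ n ih =>
    have : z ^ (n + 1 + 1) - w ^ (n + 1 + 1) = z * (z ^ (n + 1) - w ^ (n + 1)) + (z - w) * w ^ (n + 1) := by ring
    rw [this]
    calc _ ≤ ‖z‖ * ‖z ^ (n + 1) - w ^ (n + 1)‖ + ‖z - w‖ * ‖w‖ ^ (n + 1) := by
          refine (norm_add_le _ _).trans ?_
          simp
      _ ≤ R * ((n + 1) * R ^ n * ‖z - w‖) + ‖z - w‖ * R ^ (n + 1) := by gcongr
      _ = _ := by push_cast; ring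

lemma bounds_aux {T : ℝ} (hT : 0 < T) {a : ℕ → ℝ → ℂ} (ha : MemX T a) :
    ∃ R > 0, ∃ L ≥ 0, T * L ≤ 1 / 2 ∧ ∀ x ∈ Set.Icc 0 T, ∀ z : ℂ, ‖z‖ ≤ R →
      (Summable fun i : ℕ => ‖a (i + 1) x * z ^ (i + 2)‖) ∧
      ∀ w : ℂ, ‖w‖ ≤ R → ‖odeF a x z - odeF a x w‖ ≤ L * ‖z - w‖ := by
  obtain ⟨-, C0, hC0⟩ := ha
  obtain ⟨C, hC1, hC⟩ : ∃ C : ℝ, 1 ≤ C ∧ ∀ i : ℕ, 1 ≤ i → ∀ x ∈ Set.Icc (0 : ℝ) T, ‖a i x‖ ≤ C ^ i := by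
    refine ⟨max |C0| 1, le_max_right _ _, fun i hi x hx => (hC0 i hi x hx).trans ?_⟩
    calc C0 ^ i ≤ |C0 ^ i| := le_abs_self _
      _ = |C0| ^ i := abs_pow _ _
      _ ≤ _ := by gcongr; exact le_max_left _ _
  have hs : Summable fun i : ℕ => ((i : ℝ) + 2) * (1 / 2 : ℝ) ^ i := by
    have h1 := summable_pow_mul_geometric_of_norm_lt_one (R := ℝ) 1 (r := 1 / 2) (by norm_num)
    have h2 := (summable_geometric_two).mul_left 2
    refine (h1.add h2).congr fun i => ?_
    simp; ring
  set K := ∑' i : ℕ, ((i : ℝ) + 2) * (1 / 2 : ℝ) ^ i with hK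
  have hK0 : 0 ≤ K := tsum_nonneg fun i => by positivity
  set q : ℝ := 1 / (2 + 2 * T * K) with hq
  have hTK : 0 ≤ T * K := by positivity
  have hq0 : 0 < q := by positivity
  have hq2 : q ≤ 1 / 2 := by
    rw [hq]; apply one_div_le_one_div_of_le <;> nlinarith
  have hqR : C * (q / C) = q := by field_simp
  have hterm : ∀ i : ℕ, C ^ (i + 1) * (q / C) ^ (i + 1) ≤ q * (1 / 2) ^ i := by
    intro i
    rw [← mul_pow, hqR, pow_succ, mul_comm]
    gcongr
  have hR0 : 0 < q / C := by positivity
  have hsum : ∀ x ∈ Set.Icc 0 T, ∀ z : ℂ, ‖z‖ ≤ q / C →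
      (Summable fun i : ℕ => ‖a (i + 1) x * z ^ (i + 2)‖) := by
    intro x hx z hz
    refine Summable.of_nonneg_of_le (fun _ => norm_nonneg _) (fun i => ?_)
      ((summable_geometric_two).mul_left (q * (q / C)))
    rw [norm_mul, norm_pow]
    calc _ ≤ C ^ (i + 1) * (q / C) ^ (i + 2) := by
          gcongr
          exact hC _ (by omega) x hx
      _ = (C ^ (i + 1) * (q / C) ^ (i + 1)) * (q / C) := by ring
      _ ≤ (q * (1 / 2) ^ i) * (q / C) := by gcongr ?_ * _; exact hterm i
      _ = _ := by ring
  refine ⟨q / C, hR0, q * K, by positivity, ?_, fun x hx z hz => ⟨hsum x hx z hz, fun w hw => ?_⟩⟩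
  · rw [hq]
    rw [one_div, ← div_eq_inv_mul, mul_div_assoc', div_le_iff₀ (by positivity)]
    nlinarith
  · unfold odeF
    rw [← Summable.tsum_sub (hsum x hx z hz).of_norm (hsum x hx w hw).of_norm]
    have hs2 := (hs.mul_left q).mul_right ‖z - w‖
    rw [hK, ← tsum_mul_left, ← tsum_mul_right]
    refine tsum_of_norm_bounded hs2.hasSum fun i => ?_
    rw [← mul_sub, norm_mul]
    calc _ ≤ C ^ (i + 1) * (((i + 1 : ℕ) + 1) * (q / C) ^ (i + 1) * ‖z - w‖) := by
          gcongr
          · exact hC _ (by omega) x hx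
          · exact pow_sub_le hz hw (i + 1)
      _ = (C ^ (i + 1) * (q / C) ^ (i + 1)) * (i + 2) * ‖z - w‖ := by push_cast; ring
      _ ≤ (q * (1 / 2) ^ i) * (i + 2) * ‖z - w‖ := by gcongr ?_ * _ * _; exact hterm i
      _ = _ := by ring

lemma odeF_zero (a : ℕ → ℝ → ℂ) (x : ℝ) : odeF a x 0 = 0 := by simp [odeF]

lemma uniq_aux {T : ℝ} {a : ℕ → ℝ → ℂ} {R L : ℝ} (hR : 0 < R) (hL0 : 0 ≤ L)
    (hTL : T * L ≤ 1 / 2)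
    (hF : ∀ x ∈ Set.Icc 0 T, ∀ z : ℂ, ‖z‖ ≤ R →
      (Summable fun i : ℕ => ‖a (i + 1) x * z ^ (i + 2)‖) ∧
      ∀ w : ℂ, ‖w‖ ≤ R → ‖odeF a x z - odeF a x w‖ ≤ L * ‖z - w‖)
    {v w : ℝ → ℂ} (hv : IsODESol T a v) (hw : IsODESol T a w) (h0 : w 0 = v 0)
    (hvR : ∀ x ∈ Set.Icc 0 T, ‖v x‖ ≤ R / 2) : Set.EqOn w v (Set.Icc 0 T) := by
  obtain ⟨⟨Kv, hKv⟩, hdv⟩ := hv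
  obtain ⟨⟨Kw, hKw⟩, hdw⟩ := hw
  rw [ae_restrict_iff' measurableSet_Icc] at hdv hdw
  have hcv := hKv.continuousOn
  have hcw := hKw.continuousOn
  have hsub : Set.Icc 0 T ⊆ {t | w t = v t} := by
    apply IsClosed.Icc_subset_of_forall_mem_nhdsWithin
    · have : IsClosed {t ∈ Set.Icc 0 T | w t = v t} := isClosed_Icc.isClosed_eq hcw hcv
      convert this using 1
      ext t; simp [and_comm]
    · exact h0
    · rintro t ⟨ht : w t = v t, ht0, htT⟩
      have htI : t ∈ Set.Icc 0 T := ⟨ht0, htT.le⟩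
      have hev : ∀ᶠ s in nhdsWithin t (Set.Icc 0 T), ‖w s‖ < R := by
        have : Filter.Tendsto (fun s => ‖w s‖) (nhdsWithin t (Set.Icc 0 T)) (nhds ‖w t‖) :=
          (hcw t htI).norm
        refine this.eventually_lt_const ?_
        rw [ht]; linarith [hvR t htI]
      rw [eventually_nhdsWithin_iff, Metric.eventually_nhds_iff] at hev
      obtain ⟨δ, hδ, hev⟩ := hev
      obtain ⟨u, htu, huu⟩ : ∃ u, t < u ∧ u ≤ T ∧ u < t + δ := by
        refine ⟨min T (t + δ / 2), lt_min htT (by linarith), min_le_left _ _, ?_⟩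
        exact lt_of_le_of_lt (min_le_right _ _) (by linarith)
      have hsubI : Set.Icc t u ⊆ Set.Icc 0 T := Set.Icc_subset_Icc ht0 huu.1
      have hwR : ∀ s ∈ Set.Icc t u, ‖w s‖ ≤ R := by
        intro s hs
        refine (hev ?_ (hsubI hs)).le
        rw [Real.dist_eq, abs_of_nonneg (by linarith [hs.1])]
        linarith [hs.2]
      have hcd : ContinuousOn (fun s => ‖w s - v s‖) (Set.Icc t u) :=
        ((hcw.mono hsubI).sub (hcv.mono hsubI)).norm
      obtain ⟨s0, hs0, hmax⟩ := isCompact_Icc.exists_isMaxOn (Set.nonempty_Icc.2 htu.le) hcd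
      have hmv : ‖(w - v) s0 - (w - v) t‖ ≤ L * ‖w s0 - v s0‖ * (s0 - t) := by
        have hsub0 : Set.Icc t s0 ⊆ Set.Icc t u := Set.Icc_subset_Icc le_rfl hs0.2
        have hlip : LipschitzOnWith (Kw + Kv) (w - v) (Set.Icc t s0) := by
          exact (hKw.sub hKv).mono (hsub0.trans hsubI)
        refine mvt_aux hs0.1 hlip ?_
        filter_upwards [hdv, hdw] with x h1 h2 hx
        have hxT := hsubI (hsub0 hx)
        refine ⟨_, (h2 hxT).2.sub (h1 hxT).2, ?_⟩
        refine ((hF x hxT (w x) (hwR x (hsub0 hx))).2 (v x) (by linarith [hvR x hxT])).trans ?_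
        gcongr
        exact hmax (hsub0 hx)
      have h5 : ‖w s0 - v s0‖ ≤ 0 := by
        simp only [Pi.sub_apply, ht, sub_self, sub_zero] at hmv
        have : L * (s0 - t) ≤ 1 / 2 := by
          refine le_trans ?_ hTL
          rw [mul_comm]; gcongr; linarith [hs0.2, huu.1]
        nlinarith [norm_nonneg (w s0 - v s0)]
      have : Set.Icc t u ∈ nhdsWithin t (Set.Ioi t) := Icc_mem_nhdsGT htu
      filter_upwards [this] with s hs
      have h6 : ‖w s - v s‖ ≤ ‖w s0 - v s0‖ := hmax hs
      exact sub_eq_zero.1 (norm_le_zero_iff.1 (h6.trans h5))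
  exact fun x hx => hsub hx

lemma exist_aux {T : ℝ} (hT : 0 < T) {a : ℕ → ℝ → ℂ} (ha : MemX T a) {R L : ℝ} (hR : 0 < R)
    (hL0 : 0 ≤ L) (hTL : T * L ≤ 1 / 2)
    (hF : ∀ x ∈ Set.Icc 0 T, ∀ z : ℂ, ‖z‖ ≤ R →
      (Summable fun i : ℕ => ‖a (i + 1) x * z ^ (i + 2)‖) ∧
      ∀ w : ℂ, ‖w‖ ≤ R → ‖odeF a x z - odeF a x w‖ ≤ L * ‖z - w‖)
    {r : ℂ} (hr : ‖r‖ ≤ R / 2) :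
    ∃ v : ℝ → ℂ, v 0 = r ∧ IsODESol T a v ∧ ∀ x ∈ Set.Icc 0 T, ‖v x‖ ≤ R := by
  have hmem : ∀ (u : C(Set.Icc (0 : ℝ) T, ℂ)), ‖u‖ ≤ R → ∀ y, ‖u y‖ ≤ R :=
    fun u hu y => (u.norm_coe_le_norm y).trans hu
  let G : C(Set.Icc (0 : ℝ) T, ℂ) → ℝ → ℂ := fun u s => odeF a s (u (Set.projIcc 0 T hT.le s))
  have hGb : ∀ u, ‖u‖ ≤ R → ∀ s ∈ Set.Icc 0 T, ‖G u s‖ ≤ L * R := by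
    intro u hu s hs
    have := (hF s hs _ (hmem u hu (Set.projIcc 0 T hT.le s))).2 0 (by simpa using hR.le)
    rw [odeF_zero, sub_zero, sub_zero] at this
    refine this.trans ?_
    gcongr
    exact hmem u hu _
  have hGi : ∀ u, ‖u‖ ≤ R → IntervalIntegrable (G u) volume 0 T := by
    intro u hu
    rw [intervalIntegrable_iff_integrableOn_Icc_of_le hT.le]
    have hm : AEStronglyMeasurable (G u) (volume.restrict (Set.Icc 0 T)) := by
      refine aestronglyMeasurable_of_tendsto_ae Filter.atTop
        (f := fun n s => ∑ i ∈ Finset.range n, a (i + 1) s * (u (Set.projIcc 0 T hT.le s)) ^ (i + 2)) ?_ ?_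
      · intro n
        have hc : Measurable fun s => u (Set.projIcc 0 T hT.le s) :=
          (u.continuous.comp continuous_projIcc).measurable
        have : Measurable fun s => ∑ i ∈ Finset.range n, a (i + 1) s * (u (Set.projIcc 0 T hT.le s)) ^ (i + 2) :=
          Finset.measurable_sum _ fun i _ => (ha.1 (i + 1)).mul (hc.pow_const _)
        exact this.aestronglyMeasurable
      · rw [ae_restrict_iff' measurableSet_Icc]
        refine Filter.Eventually.of_forall fun s hs => ?_
        exact (hF s hs _ (hmem u hu _)).1.of_norm.hasSum.tendsto_sum_nat
    refine IntegrableOn.of_bound (C := L * R) (by simp) hm ?_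
    rw [ae_restrict_iff' measurableSet_Icc]
    exact Filter.Eventually.of_forall fun s hs => hGb u hu s hs
  have hlip : ∀ u, ‖u‖ ≤ R → LipschitzOnWith (L * R).toNNReal (fun x => ∫ t in (0:ℝ)..x, G u t) (Set.Icc 0 T) :=
    fun u hu => lip_int hT.le (hGi u hu) (Filter.Eventually.of_forall (hGb u hu))
  -- norm bound for the integral of a function bounded on the interval
  have hnb : ∀ (g : ℝ → ℂ) (M : ℝ), 0 ≤ M → (∀ s ∈ Set.Icc 0 T, ‖g s‖ ≤ L * M) →
      ∀ x ∈ Set.Icc 0 T, ‖∫ t in (0:ℝ)..x, g t‖ ≤ M / 2 := by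
    intro g M hM hg x hx
    have := intervalIntegral.norm_integral_le_of_norm_le_const (a := 0) (b := x) (f := g) (C := L * M) (by
      intro s hs
      rw [Set.uIoc_of_le hx.1] at hs
      exact hg s ⟨hs.1.le, hs.2.trans hx.2⟩)
    rw [sub_zero, abs_of_nonneg hx.1] at this
    have h2 : L * M * x ≤ L * M * T := by gcongr; exact hx.2
    nlinarith
  let Φ : Metric.closedBall (0 : C(Set.Icc (0 : ℝ) T, ℂ)) R → Metric.closedBall (0 : C(Set.Icc (0 : ℝ) T, ℂ)) R :=
    fun u => ⟨⟨fun x => r + ∫ t in (0:ℝ)..x, G u.1 t, by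
      have hu : ‖u.1‖ ≤ R := mem_closedBall_zero_iff.1 u.2
      exact continuous_const.add (continuousOn_iff_continuous_domRestrict.1 (hlip u.1 hu).continuousOn)⟩, by
      have hu : ‖u.1‖ ≤ R := mem_closedBall_zero_iff.1 u.2
      rw [mem_closedBall_zero_iff, ContinuousMap.norm_le _ hR.le]
      intro x
      refine (norm_add_le _ _).trans ?_
      have := hnb (G u.1) R hR.le (hGb u.1 hu) x x.2
      linarith⟩
  have hΦ : ∀ u x, (Φ u).1 x = r + ∫ t in (0:ℝ)..x, G u.1 t := fun u x => rfl
  have hcon : ContractingWith (1 / 2) Φ := by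
    refine ⟨by rw [← NNReal.coe_lt_coe]; norm_num, LipschitzWith.of_dist_le_mul fun u w => ?_⟩
    have hu : ‖u.1‖ ≤ R := mem_closedBall_zero_iff.1 u.2
    have hw : ‖w.1‖ ≤ R := mem_closedBall_zero_iff.1 w.2
    rw [Subtype.dist_eq, Subtype.dist_eq, ContinuousMap.dist_le (by positivity)]
    intro x
    have hsub : ∀ u, ‖u‖ ≤ R → IntervalIntegrable (G u) volume 0 x := fun u hu =>
      (hGi u hu).mono_set (Set.uIcc_subset_uIcc (by simp) (by rw [Set.uIcc_of_le hT.le]; exact x.2))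
    rw [hΦ, hΦ, dist_add_left, dist_eq_norm, ← intervalIntegral.integral_sub (hsub _ hu) (hsub _ hw)]
    refine (hnb _ (dist u.1 w.1) dist_nonneg (fun s hs => ?_) x x.2).trans (le_of_eq ?_)
    · refine ((hF s hs _ (hmem _ hu _)).2 _ (hmem _ hw _)).trans ?_
      gcongr
      rw [← dist_eq_norm]
      exact ContinuousMap.dist_apply_le_dist _
    · push_cast; ring
  have : Nonempty (Metric.closedBall (0 : C(Set.Icc (0 : ℝ) T, ℂ)) R) := ⟨⟨0, by simp [hR.le]⟩⟩
  have : CompleteSpace (Metric.closedBall (0 : C(Set.Icc (0 : ℝ) T, ℂ)) R) :=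
    Metric.isClosed_closedBall.isComplete.completeSpace_coe
  have hfix := hcon.fixedPoint_isFixedPt
  set u := ContractingWith.fixedPoint Φ hcon with hudef
  have hu : ‖u.1‖ ≤ R := mem_closedBall_zero_iff.1 u.2
  have hux : ∀ x (hx : x ∈ Set.Icc 0 T), r + ∫ t in (0:ℝ)..x, G u.1 t = u.1 ⟨x, hx⟩ := by
    intro x hx
    have := hΦ u ⟨x, hx⟩
    rw [hfix] at this
    exact this.symm
  refine ⟨fun x => r + ∫ t in (0:ℝ)..x, G u.1 t, by simp, ⟨⟨0 + (L * R).toNNReal, ?_⟩, ?_⟩, ?_⟩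
  · exact (LipschitzWith.const r).lipschitzOnWith.add (hlip u.1 hu)
  · rw [ae_restrict_iff' measurableSet_Icc]
    filter_upwards [(hGi u.1 hu).ae_hasDerivAt_integral] with x hx hxT
    rw [hux x hxT]
    refine ⟨(hF x hxT _ (hmem _ hu _)).1, ?_⟩
    rw [Set.uIcc_of_le hT.le] at hx
    have h1 := (hx hxT 0 (by simp [hT.le])).const_add r
    have h2 : G u.1 x = ∑' i : ℕ, a (i + 1) x * (u.1 ⟨x, hxT⟩) ^ (i + 2) := by
      simp only [G, odeF, Set.projIcc_of_mem hT.le hxT]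
    rw [h2] at h1
    exact h1
  · intro x hx
    show ‖r + ∫ t in (0:ℝ)..x, G u.1 t‖ ≤ R
    rw [hux x hx]
    exact hmem _ hu _

lemma main_aux {T : ℝ} (hT : 0 < T) {a : ℕ → ℝ → ℂ} (ha : MemX T a) {δ : ℝ} (hδ : 0 < δ) :
    ∃ ε > (0 : ℝ), ∀ r : ℂ, ‖r‖ < ε → ∃ v : ℝ → ℂ, v 0 = r ∧ IsODESol T a v ∧
      (∀ w : ℝ → ℂ, w 0 = r → IsODESol T a w → Set.EqOn w v (Set.Icc 0 T)) ∧ ‖v T‖ < δ := by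
  obtain ⟨R, hR, L, hL, hTL, hF⟩ := bounds_aux hT ha
  set R' := min (R / 2) (δ / 2) with hR'
  have h0 : 0 < R' := lt_min (by linarith) (by linarith)
  have h1 : R' ≤ R / 2 := min_le_left _ _
  have h2 : R' ≤ δ / 2 := min_le_right _ _
  refine ⟨R' / 2, by linarith, fun r hr => ?_⟩
  obtain ⟨v, hv0, hv, hvR⟩ := exist_aux hT ha h0 hL hTL (fun x hx z hz =>
    ⟨(hF x hx z (by linarith)).1, fun w hw => (hF x hx z (by linarith)).2 w (by linarith)⟩) hr.le
  refine ⟨v, hv0, hv, fun w hw0 hw => ?_, ?_⟩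
  · exact uniq_aux hR hL hTL hF hv hw (by rw [hw0, hv0]) (fun x hx => (hvR x hx).trans h1)
  · linarith [hvR T ⟨hT.le, le_rfl⟩]

lemma memX_starProd {T : ℝ} {a b : ℕ → ℝ → ℂ} (ha : MemX T a) (hb : MemX T b) :
    MemX T (starProd T a b) := by
  obtain ⟨hma, Ca, hCa⟩ := ha
  obtain ⟨hmb, Cb, hCb⟩ := hb
  refine ⟨fun i => ?_, 2 * max |Ca| |Cb|, fun i hi x hx => ?_⟩
  · unfold starProd
    refine Measurable.ite measurableSet_Iic ?_ ?_
    · exact ((hmb i).comp (measurable_const.mul measurable_id)).const_mul 2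
    · exact ((hma i).comp ((measurable_const.mul measurable_id).sub_const T)).const_mul 2
  · have key : ∀ (z : ℂ) (C : ℝ), ‖z‖ ≤ C ^ i → |C| ≤ max |Ca| |Cb| → ‖2 * z‖ ≤ (2 * max |Ca| |Cb|) ^ i := by
      intro z C hz hC
      rw [norm_mul, mul_pow]
      have h1 : ‖(2 : ℂ)‖ ≤ 2 ^ i := by
        rw [Complex.norm_ofNat]
        exact le_self_pow₀ (by norm_num) (by omega)
      have h2 : ‖z‖ ≤ (max |Ca| |Cb|) ^ i := by
        refine hz.trans ((le_abs_self _).trans ?_)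
        rw [abs_pow]; gcongr
      gcongr
    unfold starProd
    split_ifs with h
    · exact key _ Cb (hCb i hi _ ⟨by linarith [hx.1], by linarith⟩) (le_max_right _ _)
    · exact key _ Ca (hCa i hi _ ⟨by linarith, by linarith [hx.2]⟩) (le_max_left _ _)

lemma ae_affine {P : ℝ → Prop} (h : ∀ᵐ x, P x) (c : ℝ) : ∀ᵐ x, P ((x + c) / 2) := by
  have h1 := (Measure.quasiMeasurePreserving_smul (E := ℝ) (μ := volume) (r := (1 / 2 : ℝ)) (by norm_num)).ae h
  have h2 := (measurePreserving_add_right (volume : Measure ℝ) c).quasiMeasurePreserving.ae h1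
  filter_upwards [h2] with x hx
  convert hx using 1
  simp; ring

lemma rescale_aux {T : ℝ} (hT : 0 < T) {a e : ℕ → ℝ → ℂ} {v : ℝ → ℂ} (hv : IsODESol T e v) {c : ℝ}
    (hc0 : 0 ≤ c) (hcT : c ≤ T)
    (he : ∀ i, ∀ x, 0 < x → x ≤ T → e i ((x + c) / 2) = 2 * a i x) :
    IsODESol T a (fun x => v ((x + c) / 2)) := by
  obtain ⟨⟨K, hK⟩, hd⟩ := hv
  have hmaps : ∀ x ∈ Set.Icc 0 T, (x + c) / 2 ∈ Set.Icc 0 T := fun x hx =>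
    ⟨by linarith [hx.1], by linarith [hx.2]⟩
  refine ⟨⟨K, ?_⟩, ?_⟩
  · refine LipschitzOnWith.of_dist_le_mul fun x hx y hy => ?_
    refine (hK.dist_le_mul _ (hmaps x hx) _ (hmaps y hy)).trans ?_
    gcongr
    rw [Real.dist_eq, Real.dist_eq, show (x + c) / 2 - (y + c) / 2 = (x - y) / 2 by ring, abs_div]
    norm_num
  · rw [ae_restrict_iff' measurableSet_Icc] at hd ⊢
    have hne : ∀ᵐ x : ℝ, x ≠ 0 := by
      simp [ae_iff]
    filter_upwards [ae_affine hd c, hne] with x hx hx0 hxT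
    obtain ⟨hs, hder⟩ := hx (hmaps x hxT)
    have hpos : 0 < x := lt_of_le_of_ne hxT.1 (Ne.symm hx0)
    simp only [he _ x hpos hxT.2, mul_assoc] at hs hder
    constructor
    · refine (hs.mul_left (1 / 2)).congr fun i => ?_
      rw [norm_mul 2, Complex.norm_ofNat]; ring
    · have h1 : HasDerivAt (fun x : ℝ => (x + c) / 2) (1 / 2) x :=
        ((hasDerivAt_id x).add_const c).div_const 2
      have h2 := hder.scomp x h1
      rw [tsum_mul_left] at h2
      have h3 : ∀ z : ℂ, ((1 / 2 : ℝ)) • (2 * z) = z := by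
        intro z; rw [Complex.real_smul]; push_cast; ring
      rw [h3] at h2
      exact h2

/-- composition of first return maps: for all `a, b ∈ X` there is `ε > 0`
such that for `|r| < ε` the (unique) Lipschitz solutions `v(·;r;b)`, `v(·;v(T;r;b);a)` and
`v(·;r;a*b)` all exist on `[0,T]` and `v(T;r;a*b) = v(T;v(T;r;b);a)`. -/
theorem first_return_map_starProd (T : ℝ) (hT : 0 < T) (a b : ℕ → ℝ → ℂ)
    (ha : MemX T a) (hb : MemX T b) :
    ∃ ε > (0 : ℝ), ∀ r : ℂ, ‖r‖ < ε →
      ∃ vb va vab : ℝ → ℂ,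
        vb 0 = r ∧ IsODESol T b vb ∧
        (∀ w : ℝ → ℂ, w 0 = r → IsODESol T b w → Set.EqOn w vb (Set.Icc 0 T)) ∧
        va 0 = vb T ∧ IsODESol T a va ∧
        (∀ w : ℝ → ℂ, w 0 = vb T → IsODESol T a w → Set.EqOn w va (Set.Icc 0 T)) ∧
        vab 0 = r ∧ IsODESol T (starProd T a b) vab ∧
        (∀ w : ℝ → ℂ, w 0 = r → IsODESol T (starProd T a b) w →
          Set.EqOn w vab (Set.Icc 0 T)) ∧
        vab T = va T := by
  obtain ⟨ε1, hε1, Ha⟩ := main_aux hT ha one_pos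
  obtain ⟨ε2, hε2, Hb⟩ := main_aux hT hb hε1
  obtain ⟨ε3, hε3, Hab⟩ := main_aux hT (memX_starProd ha hb) one_pos
  refine ⟨min ε2 ε3, lt_min hε2 hε3, fun r hr => ?_⟩
  obtain ⟨vb, hb0, hbs, hbu, hbT⟩ := Hb r (hr.trans_le (min_le_left _ _))
  obtain ⟨va, ha0, has, hau, -⟩ := Ha (vb T) hbT
  obtain ⟨vab, hab0, habs, habu, -⟩ := Hab r (hr.trans_le (min_le_right _ _))
  refine ⟨vb, va, vab, hb0, hbs, hbu, ha0, has, hau, hab0, habs, habu, ?_⟩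
  have hTT : T ∈ Set.Icc 0 T := ⟨hT.le, le_rfl⟩
  have s1 : IsODESol T b (fun x => vab ((x + 0) / 2)) := by
    refine rescale_aux hT habs le_rfl hT.le fun i x h0 h1 => ?_
    unfold starProd
    rw [if_pos (by linarith)]
    congr 2; ring
  have e1 := hbu _ (by simpa using hab0) s1 hTT
  have s2 : IsODESol T a (fun x => vab ((x + T) / 2)) := by
    refine rescale_aux hT habs hT.le le_rfl fun i x h0 h1 => ?_
    unfold starProd
    rw [if_neg (by linarith)]
    congr 2; ring
  have e2 := hau _ (by simpa using e1) s2 hTT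
  simpa using e2
end
end
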